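/- Let p be a prime, n ≥ 1 an integer, and ε ∈ ℤ. Let f : ℚ_p → ℚ_p be a definable function and set D = {x ∈ ℚ_p : x ≠ 0, v(x) ≥ ε, x ∈ P_n}. Assume ‖f x‖ = 1 for every x ∈ D (i.e. f takes values in the units ℤ_pˣ on D). Then there exist an integer δ ≥ ε, a positive multiple m of n, and L ∈ ℚ_p with ‖L‖ = 1 such that f x tends to L as x → 0 within {x ∈ ℚ_p : x ≠ 0, v(x) ≥ δ, x ∈ P_m}. -/

import Mathlib

open FirstOrder Filter Topology

/-- The ring-language structure on `ℚ_[p]`. -/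
noncomputable instance (p : ℕ) [Fact p.Prime] : FirstOrder.Language.ring.Structure ℚ_[p] :=
  (FirstOrder.Ring.compatibleRingOfRing ℚ_[p]).toStructure

section NearConst

open Polynomial

variable {K Γ₀ G : Type*} [Field K] [LinearOrderedCommGroupWithZero Γ₀] [CommRing G]

/-- `Q` varies less than its own size on the ball around `c` of radius that of `e`,
expressed through the Taylor coefficients of `Q` at `c`. -/
def NearConst (v : Valuation K Γ₀) (π : G →+* K) (Q : G[X]) (c e : G) : Prop :=
  ∀ j, 1 ≤ j → v (π ((taylor c Q).coeff j * e ^ j)) < v (π (Q.eval c))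

lemma valuation_coeff_mul_le_one {v : Valuation K Γ₀} {P Q : K[X]}
    (hP : ∀ i, v (P.coeff i) ≤ 1) (hQ : ∀ i, v (Q.coeff i) ≤ 1) (i : ℕ) :
    v ((P * Q).coeff i) ≤ 1 := by
  rw [coeff_mul]
  refine v.map_sum_le fun x _ => ?_
  rw [map_mul]
  exact mul_le_one' (hP _) (hQ _)

lemma valuation_coeff_lagrange_basis_le_one {v : Valuation K Γ₀}
    (hv : ∀ n : ℕ, n ≠ 0 → v (n : K) = 1) (s : Finset ℕ) (t : ℕ) (i : ℕ) :
    v ((Lagrange.basis s (fun n : ℕ => (n : K)) t).coeff i) ≤ 1 := by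
  have hle : ∀ n : ℕ, v (n : K) ≤ 1 := fun n => by
    rcases eq_or_ne n 0 with rfl | h
    · simp
    · exact (hv n h).le
  unfold Lagrange.basis
  revert i
  refine Finset.prod_induction _ (fun P : K[X] => ∀ i, v (P.coeff i) ≤ 1)
    (fun _ _ ha hb => valuation_coeff_mul_le_one ha hb) ?_ ?_
  · intro i
    rw [coeff_one]
    split_ifs <;> simp
  · intro j hj
    rw [Finset.mem_erase] at hj
    unfold Lagrange.basisDivisor
    have hdiff : v ((t : K) - j) = 1 := by
      rcases lt_or_gt_of_ne hj.1 with h | h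
      · have := hv (t - j) (by omega)
        rwa [Nat.cast_sub h.le] at this
      · have := hv (j - t) (by omega)
        rw [Nat.cast_sub h.le] at this
        rwa [v.map_sub_swap]
    refine valuation_coeff_mul_le_one (fun i => ?_) (fun i => ?_)
    · rw [coeff_C]
      split_ifs
      · rw [map_inv₀, hdiff, inv_one]
      · simp
    · rw [coeff_sub, coeff_X, coeff_C]
      refine v.map_sub_le ?_ ?_
      · split_ifs <;> simp
      · split_ifs
        · exact hle j
        · simp

/-- In residue characteristic zero, a polynomial that is small at all natural numbers has small
coefficients. -/
lemma valuation_coeff_lt_of_eval_nat_lt {v : Valuation K Γ₀}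
    (hv : ∀ n : ℕ, n ≠ 0 → v (n : K) = 1) (Q : K[X]) {g : Γ₀}
    (hQ : ∀ s : ℕ, v (Q.eval (s : K)) < g) (i : ℕ) : v (Q.coeff i) < g := by
  have hinj : Set.InjOn (fun n : ℕ => (n : K)) (Finset.range (Q.natDegree + 1) : Set ℕ) := by
    intro a _ b _ hab
    by_contra hne
    wlog h : a < b generalizing a b
    · exact this ‹_› ‹_› hab.symm (Ne.symm hne) (by omega)
    have h1 := hv (b - a) (by omega)
    rw [Nat.cast_sub h.le] at h1
    simp only at hab
    simp [hab] at h1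
  have h0 : 0 < g := lt_of_le_of_lt zero_le (hQ 0)
  have hdeg : Q.degree < (Finset.range (Q.natDegree + 1)).card := by
    rw [Finset.card_range]
    exact (degree_le_natDegree).trans_lt (by exact_mod_cast Nat.lt_succ_self _)
  rw [Lagrange.eq_interpolate hinj hdeg, Lagrange.interpolate_apply, finsetSum_coeff]
  refine v.map_sum_lt' h0 fun t _ => ?_
  rw [coeff_C_mul, map_mul]
  exact (mul_le_of_le_one_right' (valuation_coeff_lagrange_basis_le_one hv _ _ _)).trans_lt (hQ t)

lemma eval₂_eq_sum_taylor (π : G →+* K) (Q : G[X]) (c : G) (y : K) :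
    Q.eval₂ π y = ∑ i ∈ Finset.range (Q.natDegree + 1),
      π ((taylor c Q).coeff i) * (y - π c) ^ i := by
  have h : Q.eval₂ π y = (taylor c Q).eval₂ π (y - π c) := by
    rw [taylor_apply, eval₂_comp]
    simp
  rw [h, eval₂_eq_sum_range, natDegree_taylor]

lemma NearConst.eval₂_sub_lt {v : Valuation K Γ₀} {π : G →+* K} {Q : G[X]} {c e : G}
    (h : NearConst v π Q c e) {y : K} (hy : v (y - π c) ≤ v (π e)) :
    v (Q.eval₂ π y - π (Q.eval c)) < v (π (Q.eval c)) := by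
  rw [eval₂_eq_sum_taylor π Q c, Finset.sum_range_succ']
  simp only [pow_zero, mul_one, taylor_coeff_zero, add_sub_cancel_right]
  have h0 : 0 < v (π (Q.eval c)) := lt_of_le_of_lt zero_le (h 1 le_rfl)
  refine v.map_sum_lt' h0 fun i _ => ?_
  refine lt_of_le_of_lt ?_ (h (i + 1) (by omega))
  rw [map_mul, map_mul, map_mul, map_pow, map_pow, map_pow]
  exact mul_le_mul_right (pow_le_pow_left' hy _) _

lemma NearConst.eval₂_eq {v : Valuation K Γ₀} {π : G →+* K} {Q : G[X]} {c e : G}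
    (h : NearConst v π Q c e) {y : K} (hy : v (y - π c) ≤ v (π e)) :
    v (Q.eval₂ π y) = v (π (Q.eval c)) := by
  have := v.map_add_eq_of_lt_left (h.eval₂_sub_lt hy)
  simpa using this

lemma nearConst_of_nat {v : Valuation K Γ₀} (hv : ∀ n : ℕ, n ≠ 0 → v (n : K) = 1)
    {π : G →+* K} {Q : G[X]} {c e : G}
    (h : ∀ s : ℕ, v (π (Q.eval (c + e * s)) - π (Q.eval c)) < v (π (Q.eval c))) :
    NearConst v π Q c e := by
  intro j hj
  have key := valuation_coeff_lt_of_eval_nat_lt hv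
    ((((taylor c Q).comp (C e * X)).map π) - C (π (Q.eval c))) (g := v (π (Q.eval c)))
    (fun s => ?_) j
  · rw [coeff_sub, coeff_C, if_neg (by omega), sub_zero, coeff_map, comp_C_mul_X_coeff] at key
    exact key
  · have := h s
    rw [eval_sub, eval_C, eval_map, ← map_natCast π, eval₂_at_apply, eval_comp, taylor_eval]
    simpa [add_comm] using this

/-- Near constancy passes to smaller balls. -/
lemma NearConst.mono {v : Valuation K Γ₀} (hv : ∀ n : ℕ, n ≠ 0 → v (n : K) = 1)
    {π : G →+* K} {Q : G[X]} {c e c' e' : G} (h : NearConst v π Q c e)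
    (hc : v (π c' - π c) ≤ v (π e)) (he : v (π e') ≤ v (π e)) : NearConst v π Q c' e' := by
  have hle : ∀ n : ℕ, v (n : K) ≤ 1 := fun n => by
    rcases eq_or_ne n 0 with rfl | h
    · simp
    · exact (hv n h).le
  have h1 := h.eval₂_sub_lt hc
  have h1' := h.eval₂_eq hc
  rw [eval₂_at_apply] at h1 h1'
  refine nearConst_of_nat hv fun s => ?_
  have h2 : v (π (c' + e' * s) - π c) ≤ v (π e) := by
    have : π (c' + e' * s) - π c = (π c' - π c) + π e' * (s : K) := by simp; ring
    rw [this]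
    refine v.map_add_le hc ?_
    rw [map_mul]
    exact (mul_le_of_le_one_right' (hle s)).trans he
  have h3 := h.eval₂_sub_lt h2
  rw [eval₂_at_apply] at h3
  rw [h1']
  have := v.map_sub_lt h3 h1
  simpa using this

end NearConst

section PartialIso

open Polynomial

/-- The elements having roots of every positive order. -/
def infDivisible (K : Type*) [Field K] : Set K := {w | ∀ n : ℕ, 0 < n → ∃ y, y ^ n = w}

/-- The properties of an ultrapower of `k` and its coarse valuation that are used in the
back-and-forth argument. -/
structure IsSaturatedHenselian {K Γ₀ : Type*} [Field K] [LinearOrderedCommGroupWithZero Γ₀]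
    (k : Type*) [Field k] [Algebra k K] (v : Valuation K Γ₀) : Prop where
  charZero : CharZero k
  valuation_const : ∀ s : k, s ≠ 0 → v (algebraMap k K s) = 1
  exists_residue : ∀ z : K, v z ≤ 1 → ∃ s : k, v (z - algebraMap k K s) < 1
  exists_root : ∀ P : K[X], v (P.coeff 0) ≤ 1 → P.coeff 1 = 1 → (∀ i, 2 ≤ i → v (P.coeff i) < 1) →
    ∃ z, v z ≤ 1 ∧ P.eval z = 0
  exists_valuation_pow : ∀ (z : K) (n : ℕ), 0 < n → ∃ y, v (y ^ n) = v z
  exists_infDivisible_pow : ∀ w ∈ infDivisible K, ∀ n : ℕ, 0 < n → ∃ u ∈ infDivisible K, u ^ n = w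
  exists_infDivisible_between : ∀ a b : ℕ → K, (∀ i j, v (a i * b j) < 1) →
    ∃ w ∈ infDivisible K, w ≠ 0 ∧ ∀ i, v (a i) < v w ∧ v (w * b i) < 1
  exists_mem_balls : ∀ c e : ℕ → K, (∀ i j, i ≤ j → v (c j - c i) < v (e i)) →
    ∃ b, ∀ i, v (b - c i) ≤ v (e i)

namespace IsSaturatedHenselian

variable {K Γ₀ k : Type*} [Field K] [LinearOrderedCommGroupWithZero Γ₀] [Field k] [Algebra k K]
  {v : Valuation K Γ₀}

lemma valuation_natCast (H : IsSaturatedHenselian k v) (n : ℕ) (hn : n ≠ 0) :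
    v (n : K) = 1 := by
  have := H.charZero
  have h := H.valuation_const (n : k) (by exact_mod_cast hn)
  simpa using h

lemma one_add_mem_infDivisible (H : IsSaturatedHenselian k v) {x : K} (hx : v x < 1) :
    1 + x ∈ infDivisible K := by
  intro n hn
  have hn0 : (n : K) ≠ 0 := by
    have := H.valuation_natCast n hn.ne'
    intro h
    simp [h] at this
  rcases eq_or_ne x 0 with rfl | hx0
  · exact ⟨1, by simp⟩
  have hle : ∀ n : ℕ, v (n : K) ≤ 1 := fun n => by
    rcases eq_or_ne n 0 with rfl | h
    · simp
    · exact (H.valuation_natCast n h).le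
  set P : K[X] := C (n : K)⁻¹ * (C x⁻¹ * ((1 + C x * X) ^ n - C (1 + x))) with hP
  have hcoeff : ∀ i, P.coeff i = (n : K)⁻¹ * (x⁻¹ * (x ^ i * (n.choose i : K)
      - if i = 0 then 1 + x else 0)) := by
    intro i
    rw [hP, coeff_C_mul, coeff_C_mul, coeff_sub, coeff_C]
    have : (1 + C x * X : K[X]) ^ n = ((1 + X) ^ n).comp (C x * X) := by simp
    rw [this, comp_C_mul_X_coeff, coeff_one_add_X_pow]
    ring
  have hn1 := H.valuation_natCast n hn.ne'
  have h0 : v (P.coeff 0) ≤ 1 := by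
    rw [hcoeff]
    simp [hn1, hx0]
  have h1 : P.coeff 1 = 1 := by
    rw [hcoeff]
    simp [hn0, hx0]
  have h2 : ∀ i, 2 ≤ i → v (P.coeff i) < 1 := by
    intro i hi
    obtain ⟨j, rfl⟩ : ∃ j, i = j + 2 := ⟨i - 2, by omega⟩
    rw [hcoeff, if_neg (by omega), sub_zero, map_mul, map_inv₀, hn1, inv_one, one_mul]
    have : x⁻¹ * (x ^ (j + 2) * (n.choose (j + 2) : K)) = x ^ (j + 1) * (n.choose (j + 2) : K) := by
      field_simp
      ring
    rw [this, map_mul, map_pow]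
    refine (mul_le_of_le_one_right' (hle _)).trans_lt ?_
    exact pow_lt_one₀ zero_le hx (by omega)
  obtain ⟨z, -, hz⟩ := H.exists_root P h0 h1 h2
  refine ⟨1 + x * z, ?_⟩
  rw [hP] at hz
  simpa [hn0, hx0, sub_eq_zero] using hz

/-- Up to a constant, every element is an `n`-th power. -/
lemma exists_const_mul_pow (H : IsSaturatedHenselian k v) {b : K} (hb : b ≠ 0) (n : ℕ)
    (hn : 0 < n) : ∃ (s : k) (y : K), s ≠ 0 ∧ algebraMap k K s * y ^ n = b := by
  obtain ⟨y, hy⟩ := H.exists_valuation_pow b n hn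
  have hyn : y ^ n ≠ 0 := by
    intro h
    rw [h, map_zero, eq_comm, map_eq_zero] at hy
    exact hb hy
  have hu : v (b / y ^ n) = 1 := by
    rw [map_div₀, hy, div_self]
    simpa using hb
  obtain ⟨s, hs⟩ := H.exists_residue _ hu.le
  have hs0 : s ≠ 0 := by
    rintro rfl
    simp only [map_zero, sub_zero, hu] at hs
    exact lt_irrefl _ hs
  have hsv := H.valuation_const s hs0
  have hsK : algebraMap k K s ≠ 0 := by simpa using hs0
  have hx : v ((b / y ^ n - algebraMap k K s) / algebraMap k K s) < 1 := by
    rwa [map_div₀, hsv, div_one]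
  obtain ⟨z, hz⟩ := H.one_add_mem_infDivisible hx n hn
  refine ⟨s, z * y, hs0, ?_⟩
  rw [mul_pow, hz]
  field_simp
  ring

end IsSaturatedHenselian

end PartialIso

section Extension

open Polynomial

/-- A subring of `K × K` that is the graph of a valuation preserving isomorphism over `k` between
two subfields of `K`. -/
structure IsPartialIso {K Γ₀ : Type*} [Field K] [LinearOrderedCommGroupWithZero Γ₀]
    (k : Type*) [Field k] [Algebra k K] (v : Valuation K Γ₀) (G : Subring (K × K)) : Prop where
  le_iff : ∀ g ∈ G, ∀ h ∈ G, v g.1 ≤ v h.1 ↔ v g.2 ≤ v h.2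
  inv_mem : ∀ g ∈ G, g⁻¹ ∈ G
  const_mem : ∀ s : k, (algebraMap k K s, algebraMap k K s) ∈ G

/-- The values of the first coordinates of the elements of `G`. -/
def valueSet {K Γ₀ : Type*} [Field K] [LinearOrderedCommGroupWithZero Γ₀]
    (v : Valuation K Γ₀) (G : Subring (K × K)) : Set Γ₀ :=
  (fun g => v g.1) '' (G : Set (K × K))

namespace IsPartialIso

variable {K Γ₀ k : Type*} [Field K] [LinearOrderedCommGroupWithZero Γ₀] [Field k] [Algebra k K]
  {v : Valuation K Γ₀} {G : Subring (K × K)}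

lemma lt_iff (hG : IsPartialIso k v G) {g h : K × K} (hg : g ∈ G) (hh : h ∈ G) :
    v g.1 < v h.1 ↔ v g.2 < v h.2 := by
  rw [← not_le, ← not_le, hG.le_iff h hh g hg]

lemma eq_iff (hG : IsPartialIso k v G) {g h : K × K} (hg : g ∈ G) (hh : h ∈ G) :
    v g.1 = v h.1 ↔ v g.2 = v h.2 := by
  rw [le_antisymm_iff, le_antisymm_iff, hG.le_iff h hh g hg, hG.le_iff g hg h hh]

lemma fst_eq_zero_iff (hG : IsPartialIso k v G) {g : K × K} (hg : g ∈ G) :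
    g.1 = 0 ↔ g.2 = 0 := by
  simpa using hG.eq_iff hg G.zero_mem

lemma fst_eq_fst_iff (hG : IsPartialIso k v G) {g h : K × K} (hg : g ∈ G) (hh : h ∈ G) :
    g.1 = h.1 ↔ g.2 = h.2 := by
  simpa [sub_eq_zero] using hG.fst_eq_zero_iff (G.sub_mem hg hh)

lemma mul_inv_cancel (hG : IsPartialIso k v G) {g : K × K} (hg : g ∈ G) (h : g.1 ≠ 0) :
    g * g⁻¹ = 1 := by
  have h2 : g.2 ≠ 0 := fun h' => h ((hG.fst_eq_zero_iff hg).2 h')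
  ext <;> simp [h, h2]

/-- A partial isomorphism extends to `y` as soon as the values of polynomials in the two
coordinates of `y` compare in the same way. -/
lemma exists_adjoin (hG : IsPartialIso k v G) (y : K × K)
    (hy : ∀ P Q : G[X], v (P.eval₂ G.subtype y).1 ≤ v (Q.eval₂ G.subtype y).1 ↔
      v (P.eval₂ G.subtype y).2 ≤ v (Q.eval₂ G.subtype y).2) :
    ∃ G' : Subring (K × K), IsPartialIso k v G' ∧ G ≤ G' ∧ y ∈ G' ∧
      ∀ g ∈ G', ∃ P Q : G[X], (Q.eval₂ G.subtype y).1 ≠ 0 ∧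
        g * Q.eval₂ G.subtype y = P.eval₂ G.subtype y := by
  have hzero : ∀ Q : G[X], (Q.eval₂ G.subtype y).1 = 0 ↔ (Q.eval₂ G.subtype y).2 = 0 := by
    intro Q
    simpa using hy Q 0
  let G' : Subring (K × K) :=
    { carrier := {g | ∃ P Q : G[X], (Q.eval₂ G.subtype y).1 ≠ 0 ∧
        g * Q.eval₂ G.subtype y = P.eval₂ G.subtype y}
      mul_mem' := by
        rintro a b ⟨P, Q, hQ, h⟩ ⟨P', Q', hQ', h'⟩
        refine ⟨P * P', Q * Q', ?_, ?_⟩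
        · simp [eval₂_mul, hQ, hQ']
        · rw [eval₂_mul, eval₂_mul, ← h, ← h']; ring
      one_mem' := ⟨1, 1, by simp, by simp⟩
      add_mem' := by
        rintro a b ⟨P, Q, hQ, h⟩ ⟨P', Q', hQ', h'⟩
        refine ⟨P * Q' + P' * Q, Q * Q', ?_, ?_⟩
        · simp [eval₂_mul, hQ, hQ']
        · rw [eval₂_add, eval₂_mul, eval₂_mul, eval₂_mul, ← h, ← h']; ring
      zero_mem' := ⟨0, 1, by simp, by simp⟩
      neg_mem' := by
        rintro a ⟨P, Q, hQ, h⟩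
        exact ⟨-P, Q, hQ, by rw [eval₂_neg, ← h]; ring⟩ }
  have hGG' : G ≤ G' := fun g hg => ⟨C ⟨g, hg⟩, 1, by simp, by simp⟩
  refine ⟨G', ⟨?_, ?_, fun s => hGG' (hG.const_mem s)⟩, hGG', ⟨X, 1, by simp, by simp⟩,
    fun g hg => hg⟩
  · rintro g ⟨P, Q, hQ, h⟩ g' ⟨P', Q', hQ', h'⟩
    have hQ2 := mt (hzero Q).2 hQ
    have hQ2' := mt (hzero Q').2 hQ'
    have key := hy (P * Q') (P' * Q)
    rw [eval₂_mul, eval₂_mul, ← h, ← h'] at key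
    have e1 : v (g * eval₂ G.subtype y Q * eval₂ G.subtype y Q').1 =
        v g.1 * (v (eval₂ G.subtype y Q).1 * v (eval₂ G.subtype y Q').1) := by
      simp [mul_assoc]
    have e2 : v (g' * eval₂ G.subtype y Q' * eval₂ G.subtype y Q).1 =
        v g'.1 * (v (eval₂ G.subtype y Q).1 * v (eval₂ G.subtype y Q').1) := by
      simp [mul_comm, mul_left_comm]
    have e3 : v (g * eval₂ G.subtype y Q * eval₂ G.subtype y Q').2 =
        v g.2 * (v (eval₂ G.subtype y Q).2 * v (eval₂ G.subtype y Q').2) := by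
      simp [mul_assoc]
    have e4 : v (g' * eval₂ G.subtype y Q' * eval₂ G.subtype y Q).2 =
        v g'.2 * (v (eval₂ G.subtype y Q).2 * v (eval₂ G.subtype y Q').2) := by
      simp [mul_comm, mul_left_comm]
    rw [e1, e2, e3, e4] at key
    rwa [mul_le_mul_iff_left₀, mul_le_mul_iff_left₀] at key
    · exact mul_pos (by simpa [zero_lt_iff]) (by simpa [zero_lt_iff])
    · exact mul_pos (by simpa [zero_lt_iff]) (by simpa [zero_lt_iff])
  · rintro g ⟨P, Q, hQ, h⟩
    have hQ2 := mt (hzero Q).2 hQ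
    have h1 : g.1 * (eval₂ G.subtype y Q).1 = (eval₂ G.subtype y P).1 := congrArg Prod.fst h
    have h2 : g.2 * (eval₂ G.subtype y Q).2 = (eval₂ G.subtype y P).2 := congrArg Prod.snd h
    by_cases h0 : g.1 = 0
    · have : g.2 = 0 := by
        rw [h0, zero_mul, eq_comm, hzero, ← h2] at h1
        simpa [hQ2] using h1
      have hg : g = 0 := Prod.ext h0 this
      rw [hg]
      exact ⟨0, 1, by simp, by ext <;> simp⟩
    · have hP : (eval₂ G.subtype y P).1 ≠ 0 := by
        rw [← h1]
        exact mul_ne_zero h0 hQ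
      have hP2 := mt (hzero P).2 hP
      have h02 : g.2 ≠ 0 := by
        intro h'
        rw [h', zero_mul] at h2
        exact hP2 h2.symm
      refine ⟨Q, P, hP, ?_⟩
      rw [← h]
      ext
      · simp [h0]
      · simp [h02]

end IsPartialIso

end Extension

section Adjoin

open Polynomial

/-- The values of the first coordinates of elements of `G` are closed under `n`-th roots. -/
def HasDivisibleValues {K Γ₀ : Type*} [Field K] [LinearOrderedCommGroupWithZero Γ₀]
    (v : Valuation K Γ₀) (G : Subring (K × K)) : Prop :=
  ∀ g ∈ G, ∀ n : ℕ, 0 < n → ∃ h ∈ G, v h.1 ^ n = v g.1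

/-- The values of the two coordinates of `y` fill corresponding cuts in the values of `G`. -/
def FillsCut {K Γ₀ : Type*} [Field K] [LinearOrderedCommGroupWithZero Γ₀]
    (v : Valuation K Γ₀) (G : Subring (K × K)) (y : K × K) : Prop :=
  ∀ g ∈ G, (v y.1 < v g.1 ↔ v y.2 < v g.2) ∧ (v g.1 < v y.1 ↔ v g.2 < v y.2)

namespace IsPartialIso

variable {K Γ₀ k : Type*} [Field K] [LinearOrderedCommGroupWithZero Γ₀] [Field k] [Algebra k K]
  {v : Valuation K Γ₀} {G : Subring (K × K)}

lemma fillsCut_ne_zero {y : K × K} (hy : FillsCut v G y) (hyG : v y.1 ∉ valueSet v G) :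
    y.1 ≠ 0 ∧ y.2 ≠ 0 := by
  have h1 : y.1 ≠ 0 := by
    intro h
    exact hyG ⟨0, G.zero_mem, by simp [h]⟩
  refine ⟨h1, fun h2 => ?_⟩
  have := (hy 0 G.zero_mem).2
  simp [h2, zero_lt_iff, h1] at this

lemma pow_le_iff (hG : IsPartialIso k v G) (hdiv : HasDivisibleValues v G) {y : K × K}
    (hy : FillsCut v G y) {g : K × K} (hg : g ∈ G) {n : ℕ} (hn : 0 < n) :
    (v y.1 ^ n ≤ v g.1 ↔ v y.2 ^ n ≤ v g.2) ∧ (v g.1 ≤ v y.1 ^ n ↔ v g.2 ≤ v y.2 ^ n) := by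
  obtain ⟨h, hh, e1⟩ := hdiv g hg n hn
  have e2 : v h.2 ^ n = v g.2 := by
    have := hG.eq_iff (G.pow_mem hh n) hg
    simpa [e1] using this
  rw [← e1, ← e2, pow_le_pow_iff_left₀ zero_le zero_le hn.ne',
    pow_le_pow_iff_left₀ zero_le zero_le hn.ne', pow_le_pow_iff_left₀ zero_le zero_le hn.ne',
    pow_le_pow_iff_left₀ zero_le zero_le hn.ne', ← not_lt, ← not_lt, (hy h hh).2,
    ← not_lt, ← not_lt, (hy h hh).1]
  exact ⟨Iff.rfl, Iff.rfl⟩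

lemma monomial_le_iff (hG : IsPartialIso k v G) (hdiv : HasDivisibleValues v G) {y : K × K}
    (hy : FillsCut v G y) (hyG : v y.1 ∉ valueSet v G) {a b : K × K} (ha : a ∈ G) (hb : b ∈ G)
    (i j : ℕ) :
    v (a * y ^ i).1 ≤ v (b * y ^ j).1 ↔ v (a * y ^ i).2 ≤ v (b * y ^ j).2 := by
  obtain ⟨hy1, hy2⟩ := fillsCut_ne_zero hy hyG
  have hv1 : ∀ n, 0 < v y.1 ^ n := fun n => by simp [zero_lt_iff, hy1]
  have hv2 : ∀ n, 0 < v y.2 ^ n := fun n => by simp [zero_lt_iff, hy2]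
  have ha12 := hG.fst_eq_zero_iff ha
  have hb12 := hG.fst_eq_zero_iff hb
  by_cases ha0 : a.1 = 0
  · simp [ha0, ha12.1 ha0]
  have ha2 := mt ha12.2 ha0
  by_cases hb0 : b.1 = 0
  · simp [hb0, hb12.1 hb0, ha0, ha2, hy1, hy2]
  have hb2 := mt hb12.2 hb0
  have hva1 : 0 < v a.1 := by simpa [zero_lt_iff]
  have hva2 : 0 < v a.2 := by simpa [zero_lt_iff]
  have hvb1 : 0 < v b.1 := by simpa [zero_lt_iff]
  have hvb2 : 0 < v b.2 := by simpa [zero_lt_iff]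
  simp only [Prod.fst_mul, Prod.snd_mul, Prod.pow_fst, Prod.pow_snd, map_mul, map_pow]
  rcases lt_trichotomy i j with h | rfl | h
  · obtain ⟨n, rfl⟩ := Nat.exists_eq_add_of_lt h
    have := (hG.pow_le_iff hdiv hy (G.mul_mem ha (hG.inv_mem b hb)) (n := n + 1) (by omega)).2
    simp only [Prod.fst_mul, Prod.snd_mul, Prod.fst_inv, Prod.snd_inv, map_mul, map_inv₀] at this
    rw [← div_eq_mul_inv, ← div_eq_mul_inv, div_le_iff₀ hvb1, div_le_iff₀ hvb2] at this
    rw [add_assoc, pow_add (v y.1) i (n + 1), pow_add (v y.2) i (n + 1), mul_comm (v y.1 ^ i), mul_comm (v y.2 ^ i), ← mul_assoc,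
      ← mul_assoc, mul_le_mul_iff_left₀ (hv1 _), mul_le_mul_iff_left₀ (hv2 _), mul_comm (v b.1),
      mul_comm (v b.2), this]
  · rw [mul_le_mul_iff_left₀ (hv1 _), mul_le_mul_iff_left₀ (hv2 _), hG.le_iff a ha b hb]
  · obtain ⟨n, rfl⟩ := Nat.exists_eq_add_of_lt h
    have := (hG.pow_le_iff hdiv hy (G.mul_mem hb (hG.inv_mem a ha)) (n := n + 1) (by omega)).1
    simp only [Prod.fst_mul, Prod.snd_mul, Prod.fst_inv, Prod.snd_inv, map_mul, map_inv₀] at this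
    rw [← div_eq_mul_inv, ← div_eq_mul_inv, le_div_iff₀ hva1, le_div_iff₀ hva2] at this
    rw [add_assoc, pow_add (v y.1) j (n + 1), pow_add (v y.2) j (n + 1), mul_comm (v y.1 ^ j), mul_comm (v y.2 ^ j), ← mul_assoc,
      ← mul_assoc, mul_le_mul_iff_left₀ (hv1 _), mul_le_mul_iff_left₀ (hv2 _), mul_comm (v a.1),
      mul_comm (v a.2), this]

lemma monomial_ne (hG : IsPartialIso k v G) (hdiv : HasDivisibleValues v G) {y : K × K}
    (hyG : v y.1 ∉ valueSet v G) {a b : K × K} (ha : a ∈ G) (hb : b ∈ G)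
    (ha0 : a.1 ≠ 0) (hb0 : b.1 ≠ 0) {i j : ℕ} (hij : i ≠ j) :
    v (a * y ^ i).1 ≠ v (b * y ^ j).1 := by
  wlog h : i < j generalizing i j a b
  · exact (this hb ha hb0 ha0 hij.symm (by omega)).symm
  intro he
  have hy1 : y.1 ≠ 0 := by
    intro h
    exact hyG ⟨0, G.zero_mem, by simp [h]⟩
  obtain ⟨n, rfl⟩ := Nat.exists_eq_add_of_lt h
  obtain ⟨h, hh, e⟩ := hdiv _ (G.mul_mem ha (hG.inv_mem b hb)) (n + 1) (by omega)
  simp only [Prod.fst_mul, Prod.fst_inv, Prod.pow_fst, map_mul, map_pow, map_inv₀] at he e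
  have hvb : v b.1 ≠ 0 := by simpa
  have hvy : v y.1 ^ i ≠ 0 := by simp [hy1]
  have : v a.1 = v b.1 * v y.1 ^ (n + 1) := by
    apply mul_right_cancel₀ hvy
    rw [he, add_assoc, pow_add]
    ac_rfl
  rw [this, mul_comm (v b.1), mul_inv_cancel_right₀ hvb] at e
  rw [pow_left_inj₀ zero_le zero_le (by omega)] at e
  exact hyG ⟨h, hh, e⟩

lemma exists_dominant_monomial (hG : IsPartialIso k v G) (hdiv : HasDivisibleValues v G)
    {y : K × K} (hy : FillsCut v G y) (hyG : v y.1 ∉ valueSet v G) (P : G[X]) :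
    ∃ a ∈ G, ∃ i : ℕ, v (P.eval₂ G.subtype y).1 = v (a * y ^ i).1 ∧
      v (P.eval₂ G.subtype y).2 = v (a * y ^ i).2 := by
  rcases eq_or_ne P 0 with rfl | hP
  · exact ⟨0, G.zero_mem, 0, by simp⟩
  obtain ⟨hy1, hy2⟩ := fillsCut_ne_zero hy hyG
  let m : ℕ → K × K := fun i => (P.coeff i : K × K) * y ^ i
  obtain ⟨i, hi, hmax⟩ := Finset.exists_max_image P.support (fun i => v (m i).1)
    (by simpa using hP)
  have hne : ∀ j ∈ P.support, (P.coeff j : K × K).1 ≠ 0 := by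
    intro j hj h0
    have := (hG.fst_eq_zero_iff (P.coeff j).2).1 h0
    rw [mem_support_iff] at hj
    exact hj (Subtype.ext (Prod.ext h0 this))
  have hlt1 : ∀ j ∈ P.support, j ≠ i → v (m j).1 < v (m i).1 := fun j hj hji =>
    lt_of_le_of_ne (hmax j hj) (hG.monomial_ne hdiv hyG (P.coeff j).2 (P.coeff i).2 (hne j hj)
      (hne i hi) hji)
  have hlt2 : ∀ j ∈ P.support, j ≠ i → v (m j).2 < v (m i).2 := fun j hj hji => by
    have := hlt1 j hj hji
    rw [← not_le] at this ⊢
    rwa [← hG.monomial_le_iff hdiv hy hyG (P.coeff i).2 (P.coeff j).2]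
  have hi1 : 0 < v (m i).1 := by
    have := hne i hi
    simp [m, zero_lt_iff, this, hy1]
  have hi2 : 0 < v (m i).2 := by
    have := mt (hG.fst_eq_zero_iff (P.coeff i).2).2 (hne i hi)
    simp [m, zero_lt_iff, this, hy2]
  have hsum : P.eval₂ G.subtype y = m i + ∑ j ∈ P.support.erase i, m j := by
    rw [eval₂_eq_sum, Polynomial.sum_def, ← Finset.add_sum_erase _ _ hi]
    rfl
  refine ⟨P.coeff i, (P.coeff i).2, i, ?_, ?_⟩
  · rw [hsum, Prod.fst_add, Prod.fst_sum]
    exact v.map_add_eq_of_lt_left (v.map_sum_lt' hi1 fun j hj =>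
      hlt1 j (Finset.mem_of_mem_erase hj) (Finset.ne_of_mem_erase hj))
  · rw [hsum, Prod.snd_add, Prod.snd_sum]
    exact v.map_add_eq_of_lt_left (v.map_sum_lt' hi2 fun j hj =>
      hlt2 j (Finset.mem_of_mem_erase hj) (Finset.ne_of_mem_erase hj))

/-- A partial isomorphism with divisible values extends to a pair filling a cut. -/
lemma exists_adjoin_of_fillsCut (hG : IsPartialIso k v G) (hdiv : HasDivisibleValues v G)
    {y : K × K} (hy : FillsCut v G y) (hyG : v y.1 ∉ valueSet v G) :
    ∃ G' : Subring (K × K), IsPartialIso k v G' ∧ G ≤ G' ∧ y ∈ G' ∧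
      (∀ g ∈ G', ∃ a ∈ G, ∃ n : ℤ, v g.1 = v a.1 * v y.1 ^ n) ∧
      ∀ G'' : Subring (K × K), IsPartialIso k v G'' → G ≤ G'' → y ∈ G'' → G' ≤ G'' := by
  obtain ⟨hy1, hy2⟩ := fillsCut_ne_zero hy hyG
  obtain ⟨G', hG', hle, hyG', hfrac⟩ := hG.exists_adjoin y fun P Q => by
    obtain ⟨a, ha, i, h1, h2⟩ := hG.exists_dominant_monomial hdiv hy hyG P
    obtain ⟨b, hb, j, h3, h4⟩ := hG.exists_dominant_monomial hdiv hy hyG Q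
    rw [h1, h2, h3, h4]
    exact hG.monomial_le_iff hdiv hy hyG ha hb i j
  refine ⟨G', hG', hle, hyG', fun g hg => ?_, fun G'' hG'' hGG'' hyG'' g hg => ?_⟩
  · obtain ⟨P, Q, hQ, h⟩ := hfrac g hg
    obtain ⟨a, ha, i, h1, -⟩ := hG.exists_dominant_monomial hdiv hy hyG P
    obtain ⟨b, hb, j, h3, -⟩ := hG.exists_dominant_monomial hdiv hy hyG Q
    refine ⟨a * b⁻¹, G.mul_mem ha (hG.inv_mem b hb), (i : ℤ) - j, ?_⟩
    have hvy : v y.1 ≠ 0 := by simpa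
    have hvQ : v (eval₂ G.subtype y Q).1 ≠ 0 := by simpa
    have hb0 : v b.1 ≠ 0 := by
      intro h0
      rw [h3] at hvQ
      simp [h0] at hvQ
    apply mul_right_cancel₀ hvQ
    have := congrArg (fun x => v x.1) h
    simp only [Prod.fst_mul, map_mul] at this
    rw [this, h1, h3]
    simp only [Prod.fst_mul, map_mul, Prod.fst_inv, map_inv₀, Prod.pow_fst, map_pow]
    rw [zpow_sub₀ hvy, zpow_natCast, zpow_natCast]
    field_simp
  · obtain ⟨P, Q, hQ, h⟩ := hfrac g hg
    have hmem : ∀ P : G[X], P.eval₂ G.subtype y ∈ G'' := by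
      intro P
      rw [eval₂_eq_sum, Polynomial.sum_def]
      exact G''.sum_mem fun i _ => G''.mul_mem (hGG'' (P.coeff i).2) (G''.pow_mem hyG'' i)
    have : g = P.eval₂ G.subtype y * (Q.eval₂ G.subtype y)⁻¹ := by
      rw [← h, mul_assoc, hG''.mul_inv_cancel (hmem Q) hQ, mul_one]
    rw [this]
    exact G''.mul_mem (hmem P) (hG''.inv_mem _ (hmem Q))

end IsPartialIso

end Adjoin

section Hensel

open Polynomial

variable {K Γ₀ k G : Type*} [Field K] [LinearOrderedCommGroupWithZero Γ₀] [Field k] [Algebra k K]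
  [CommRing G] {v : Valuation K Γ₀}

/-- The linear term of `P` dominates on the ball around `c` of radius that of `e`. -/
def HenselAt (v : Valuation K Γ₀) (π : G →+* K) (P : G[X]) (c e : G) : Prop :=
  v (π ((taylor c P).coeff 0)) ≤ v (π ((taylor c P).coeff 1 * e)) ∧
    ∀ i, 2 ≤ i → v (π ((taylor c P).coeff i * e ^ i)) < v (π ((taylor c P).coeff 1 * e))

lemma eq_of_eval_eq_of_valuation_coeff_lt {R : K[X]} (h1 : R.coeff 1 = 1)
    (h2 : ∀ i, 2 ≤ i → v (R.coeff i) < 1) {w w' : K} (hw : v w ≤ 1) (hw' : v w' ≤ 1)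
    (h : R.eval w = R.eval w') : w = w' := by
  let S : ℕ → K := fun n => ∑ i ∈ Finset.range n, w ^ i * w' ^ (n - 1 - i)
  have hS : ∀ n, v (S n) ≤ 1 := fun n => v.map_sum_le fun i _ => by
    rw [map_mul, map_pow, map_pow]
    exact mul_le_one' (pow_le_one' hw _) (pow_le_one' hw' _)
  have hN : ∃ N, R.natDegree < N + 2 := ⟨R.natDegree, by omega⟩
  obtain ⟨N, hN⟩ := hN
  have key : (1 + ∑ i ∈ Finset.range N, R.coeff (i + 2) * S (i + 2)) * (w - w') = 0 := by
    rw [← sub_eq_zero, eval_eq_sum_range' hN, eval_eq_sum_range' hN, ← Finset.sum_sub_distrib,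
      Finset.sum_range_succ', Finset.sum_range_succ'] at h
    simp only [h1, zero_add, pow_one, one_mul, pow_zero, sub_self, add_zero] at h
    rw [add_mul, Finset.sum_mul, one_mul, ← h, add_comm]
    congr 1
    refine Finset.sum_congr rfl fun i _ => ?_
    rw [mul_assoc, geom_sum₂_mul, mul_sub]
  have hv : v (1 + ∑ i ∈ Finset.range N, R.coeff (i + 2) * S (i + 2)) = 1 := by
    rw [← v.map_one]
    refine v.map_add_eq_of_lt_left ?_
    rw [v.map_one]
    refine v.map_sum_lt' one_pos fun i _ => ?_
    rw [map_mul]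
    exact (mul_le_of_le_one_right' (hS _)).trans_lt (h2 _ (by omega))
  rcases mul_eq_zero.1 key with h0 | h0
  · simp [h0] at hv
  · exact sub_eq_zero.1 h0

namespace HenselAt

variable {π : G →+* K} {P : G[X]} {c e : G}

lemma ne_zero (h : HenselAt v π P c e) : π ((taylor c P).coeff 1) ≠ 0 ∧ π e ≠ 0 := by
  have := lt_of_le_of_lt zero_le (h.2 2 le_rfl)
  constructor <;> intro h0 <;> simp [h0, -taylor_coeff_one] at this

/-- The rescaled polynomial to which Hensel's lemma applies. -/
lemma exists_rescale (h : HenselAt v π P c e) : ∃ R : K[X], v (R.coeff 0) ≤ 1 ∧ R.coeff 1 = 1 ∧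
    (∀ i, 2 ≤ i → v (R.coeff i) < 1) ∧
    ∀ w, R.eval w = 0 ↔ P.eval₂ π (π c + π e * w) = 0 := by
  obtain ⟨hT, he⟩ := h.ne_zero
  have hd : 0 < v (π ((taylor c P).coeff 1 * e)) := by
    simp [zero_lt_iff, hT, he, -taylor_coeff_one]
  let R := C (π ((taylor c P).coeff 1 * e))⁻¹ * (((taylor c P).map π).comp (C (π e) * X))
  have hcoeff : ∀ i, R.coeff i =
      π ((taylor c P).coeff i * e ^ i) / π ((taylor c P).coeff 1 * e) := by
    intro i
    rw [coeff_C_mul, comp_C_mul_X_coeff, coeff_map, map_mul π _ (e ^ i), map_pow]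
    field_simp
  refine ⟨R, ?_, ?_, fun i hi => ?_, fun w => ?_⟩
  · rw [hcoeff, map_div₀, div_le_one₀ hd]
    simpa using h.1
  · rw [hcoeff, pow_one, div_self]
    simp [hT, he, -taylor_coeff_one]
  · rw [hcoeff, map_div₀, div_lt_one₀ hd]
    exact h.2 i hi
  · have : ((taylor c P).map π).eval (π e * w) = P.eval₂ π (π c + π e * w) := by
      rw [eval_map, taylor_apply, eval₂_comp]
      simp [add_comm]
    have hx : (C (π e) * X).eval w = π e * w := by simp
    have hne : (π ((taylor c P).coeff 1 * e))⁻¹ ≠ 0 := by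
      simp [hT, he, -taylor_coeff_one]
    rw [eval_mul, eval_C, eval_comp, hx, this, mul_eq_zero, or_iff_right hne]

lemma exists_root (h : HenselAt v π P c e) (H : IsSaturatedHenselian k v) :
    ∃ z, v (z - π c) ≤ v (π e) ∧ P.eval₂ π z = 0 := by
  obtain ⟨R, h0, h1, h2, hR⟩ := h.exists_rescale
  obtain ⟨w, hw, hw0⟩ := H.exists_root R h0 h1 h2
  refine ⟨_, ?_, (hR w).1 hw0⟩
  rw [add_sub_cancel_left, map_mul]
  exact mul_le_of_le_one_right' hw

lemma root_unique (h : HenselAt v π P c e) {z z' : K} (hz : v (z - π c) ≤ v (π e))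
    (hz' : v (z' - π c) ≤ v (π e)) (h0 : P.eval₂ π z = 0) (h0' : P.eval₂ π z' = 0) : z = z' := by
  obtain ⟨R, -, h1, h2, hR⟩ := h.exists_rescale
  have he := h.ne_zero.2
  have hve : 0 < v (π e) := by simpa [zero_lt_iff]
  have hsub : ∀ z, π c + π e * ((z - π c) / π e) = z := fun z => by
    field_simp
    ring
  have hw : ∀ z, v (z - π c) ≤ v (π e) → v ((z - π c) / π e) ≤ 1 := fun z hz => by
    rwa [map_div₀, div_le_one₀ hve]
  have := eq_of_eval_eq_of_valuation_coeff_lt h1 h2 (hw z hz) (hw z' hz')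
    (by rw [(hR _).2 ((hsub z).symm ▸ h0), (hR _).2 ((hsub z').symm ▸ h0')])
  rw [← hsub z, ← hsub z', this]

end HenselAt

end Hensel

section Immediate

open Polynomial

variable {K Γ₀ k : Type*} [Field K] [LinearOrderedCommGroupWithZero Γ₀] [Field k] [Algebra k K]
  {v : Valuation K Γ₀} {G : Subring (K × K)}

/-- The first coordinate on `G`. -/
def fstHom (G : Subring (K × K)) : G →+* K := (RingHom.fst K K).comp G.subtype

/-- The second coordinate on `G`. -/
def sndHom (G : Subring (K × K)) : G →+* K := (RingHom.snd K K).comp G.subtype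

lemma eval₂_subtype_fst (Q : G[X]) (y : K × K) :
    (Q.eval₂ G.subtype y).1 = Q.eval₂ (fstHom G) y.1 :=
  hom_eval₂ Q G.subtype (RingHom.fst K K) y

lemma eval₂_subtype_snd (Q : G[X]) (y : K × K) :
    (Q.eval₂ G.subtype y).2 = Q.eval₂ (sndHom G) y.2 :=
  hom_eval₂ Q G.subtype (RingHom.snd K K) y

/-- `Q` is nearly constant on some ball with parameters in `G` containing `b`. -/
def IsTame (v : Valuation K Γ₀) (G : Subring (K × K)) (b : K) (Q : G[X]) : Prop :=
  ∃ c e : G, v (b - fstHom G c) ≤ v (fstHom G e) ∧ NearConst v (fstHom G) Q c e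

/-- The coordinates of `y` lie in all the balls with parameters in `G` that contain `b`. -/
def IsLimitPair (v : Valuation K Γ₀) (G : Subring (K × K)) (b : K) (y : K × K) : Prop :=
  ∀ c e : G, v (b - fstHom G c) ≤ v (fstHom G e) →
    v (y.1 - fstHom G c) ≤ v (fstHom G e) ∧ v (y.2 - sndHom G c) ≤ v (sndHom G e)

namespace IsPartialIso

lemma hom_le_iff (hG : IsPartialIso k v G) (g h : G) :
    v (fstHom G g) ≤ v (fstHom G h) ↔ v (sndHom G g) ≤ v (sndHom G h) :=
  hG.le_iff g g.2 h h.2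

lemma hom_lt_iff (hG : IsPartialIso k v G) (g h : G) :
    v (fstHom G g) < v (fstHom G h) ↔ v (sndHom G g) < v (sndHom G h) :=
  hG.lt_iff g.2 h.2

lemma fstHom_injective (hG : IsPartialIso k v G) : Function.Injective (fstHom G) := by
  intro g h hgh
  exact Subtype.ext (Prod.ext hgh ((hG.fst_eq_fst_iff g.2 h.2).1 hgh))

lemma nearConst_snd (hG : IsPartialIso k v G) {Q : G[X]} {c e : G}
    (h : NearConst v (fstHom G) Q c e) : NearConst v (sndHom G) Q c e :=
  fun j hj => (hG.hom_lt_iff _ _).1 (h j hj)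

lemma henselAt_snd (hG : IsPartialIso k v G) {P : G[X]} {c e : G}
    (h : HenselAt v (fstHom G) P c e) : HenselAt v (sndHom G) P c e :=
  ⟨(hG.hom_le_iff _ _).1 h.1, fun i hi => (hG.hom_lt_iff _ _).1 (h.2 i hi)⟩

lemma exists_adjoin_of_isTame (hG : IsPartialIso k v G) {b : K} {y : K × K}
    (hy : IsLimitPair v G b y)
    (hQ : ∀ Q : G[X], ∃ Q' : G[X], Q.eval₂ G.subtype y = Q'.eval₂ G.subtype y ∧
      (Q' = 0 ∨ IsTame v G b Q')) :
    ∃ G' : Subring (K × K), IsPartialIso k v G' ∧ G ≤ G' ∧ y ∈ G' ∧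
      valueSet v G' ⊆ valueSet v G := by
  have key : ∀ Q : G[X], ∃ g : G, v (Q.eval₂ G.subtype y).1 = v (fstHom G g) ∧
      v (Q.eval₂ G.subtype y).2 = v (sndHom G g) := by
    intro Q
    obtain ⟨Q', h, h0 | ⟨c, e, hce, hn⟩⟩ := hQ Q
    · exact ⟨0, by simp [h, h0]⟩
    · refine ⟨Q'.eval c, ?_, ?_⟩
      · rw [h, eval₂_subtype_fst, hn.eval₂_eq (hy c e hce).1]
      · rw [h, eval₂_subtype_snd, (hG.nearConst_snd hn).eval₂_eq (hy c e hce).2]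
  obtain ⟨G', hG', hle, hyG', hfrac⟩ := hG.exists_adjoin y fun P Q => by
    obtain ⟨g, h1, h2⟩ := key P
    obtain ⟨g', h3, h4⟩ := key Q
    rw [h1, h2, h3, h4, hG.hom_le_iff]
  refine ⟨G', hG', hle, hyG', ?_⟩
  rintro _ ⟨g, hg, rfl⟩
  obtain ⟨P, Q, hQ0, h⟩ := hfrac g hg
  obtain ⟨a, h1, -⟩ := key P
  obtain ⟨c, h3, -⟩ := key Q
  refine ⟨(a : K × K) * (c : K × K)⁻¹, G.mul_mem a.2 (hG.inv_mem _ c.2), ?_⟩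
  have := congrArg (fun x => v x.1) h
  simp only [Prod.fst_mul, map_mul, h1, h3] at this
  have hc : v (fstHom G c) ≠ 0 := by
    rw [← h3]
    simpa using hQ0
  simp only [Prod.fst_mul, Prod.fst_inv, map_mul, map_inv₀]
  change v (fstHom G a) * (v (fstHom G c))⁻¹ = _
  rw [← this, mul_inv_cancel_right₀ hc]

end IsPartialIso

end Immediate

section ImmediateExtension

open Polynomial

variable {K Γ₀ k : Type*} [Field K] [LinearOrderedCommGroupWithZero Γ₀] [Field k] [Algebra k K]
  {v : Valuation K Γ₀} {G : Subring (K × K)}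

lemma IsTame.C_mul {b : K} {Q : G[X]} (h : IsTame v G b Q) {a : G} (ha : fstHom G a ≠ 0) :
    IsTame v G b (C a * Q) := by
  obtain ⟨c, e, hce, hn⟩ := h
  refine ⟨c, e, hce, fun j hj => ?_⟩
  have hv : 0 < v (fstHom G a) := by simpa [zero_lt_iff]
  rw [taylor_mul, taylor_C, coeff_C_mul, eval_mul, eval_C, mul_assoc,
    map_mul (fstHom G) a, map_mul (fstHom G) a, map_mul v, map_mul v]
  exact (mul_lt_mul_iff_right₀ hv).2 (hn j hj)

namespace IsPartialIso

lemma exists_fst_eq_sub {b : K} (hno : ∀ c : G, ∃ d : G, v (b - fstHom G d) < v (b - fstHom G c))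
    (c : G) : ∃ e : G, v (fstHom G e) = v (b - fstHom G c) := by
  obtain ⟨d, hd⟩ := hno c
  refine ⟨d - c, ?_⟩
  have : fstHom G (d - c) = (b - fstHom G c) - (b - fstHom G d) := by
    rw [map_sub]; ring
  rw [this]
  exact v.map_sub_eq_of_lt_left hd

lemma fst_notMem_of_isLimitPair {b : K}
    (hno : ∀ c : G, ∃ d : G, v (b - fstHom G d) < v (b - fstHom G c)) {y : K × K}
    (hy : IsLimitPair v G b y) (c : G) : fstHom G c ≠ y.1 := by
  intro h
  obtain ⟨d, hd⟩ := hno c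
  obtain ⟨e, he⟩ := exists_fst_eq_sub hno d
  have h1 := (hy d e he.ge).1
  rw [he, ← h] at h1
  have h2 : b - fstHom G c = (b - fstHom G d) - (fstHom G c - fstHom G d) := by ring
  have := v.map_sub_le (le_refl _) h1
  rw [← h2] at this
  exact absurd this (not_le.2 hd)

lemma isTame_of_natDegree_eq_zero (hG : IsPartialIso k v G) {b : K}
    (hno : ∀ c : G, ∃ d : G, v (b - fstHom G d) < v (b - fstHom G c)) {Q : G[X]} (hQ : Q ≠ 0)
    (hdeg : Q.natDegree = 0) : IsTame v G b Q := by
  obtain ⟨e, he⟩ := exists_fst_eq_sub hno 0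
  refine ⟨0, e, he.ge, fun j hj => ?_⟩
  rw [eq_C_of_natDegree_eq_zero hdeg] at hQ ⊢
  have h0 : fstHom G (Q.coeff 0) ≠ 0 := by
    rw [map_ne_zero_iff _ hG.fstHom_injective]
    simpa using hQ
  rw [taylor_C, coeff_C, if_neg (by omega)]
  simpa [zero_lt_iff] using h0

lemma henselAt_of_not_isTame (H : IsSaturatedHenselian k v) {b : K} {P : G[X]}
    (hP : ¬ IsTame v G b P) {c e : G} (hce : v (b - fstHom G c) ≤ v (fstHom G e))
    (he : fstHom G e ≠ 0) (hn : NearConst v (fstHom G) (derivative P) c e) :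
    HenselAt v (fstHom G) P c e := by
  have hve : 0 < v (fstHom G e) := by simpa [zero_lt_iff]
  have h2 : ∀ i, 2 ≤ i → v (fstHom G ((taylor c P).coeff i * e ^ i)) <
      v (fstHom G ((taylor c P).coeff 1 * e)) := by
    intro i hi
    obtain ⟨j, rfl⟩ : ∃ j, i = j + 2 := ⟨i - 2, by omega⟩
    have := hn (j + 1) (by omega)
    have hder : taylor c (derivative P) = derivative (taylor c P) := by
      rw [taylor_apply, taylor_apply, derivative_comp]
      simp
    rw [← taylor_coeff_zero, hder, coeff_derivative, coeff_derivative] at this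
    simp only [map_mul, map_pow, map_add, map_natCast, map_one, Nat.cast_zero, zero_add,
      mul_one] at this ⊢
    have hnat : v (((j + 1 : ℕ) : K) + 1) = 1 := by
      have := H.valuation_natCast (j + 1 + 1) (by omega)
      rwa [Nat.cast_add_one] at this
    rw [hnat, mul_one] at this
    rw [pow_succ, ← mul_assoc]
    exact (mul_lt_mul_iff_left₀ hve).2 this
  refine ⟨?_, h2⟩
  by_contra! hlt
  refine hP ⟨c, e, hce, fun j hj => ?_⟩
  rw [← taylor_coeff_zero]
  rcases eq_or_lt_of_le hj with rfl | hj
  · rwa [pow_one]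
  · exact (h2 j hj).trans hlt

lemma exists_limitPair_of_not_isTame (hG : IsPartialIso k v G) (H : IsSaturatedHenselian k v)
    {b : K} (hno : ∀ c : G, ∃ d : G, v (b - fstHom G d) < v (b - fstHom G c))
    (hP : ∃ P : G[X], P ≠ 0 ∧ ¬ IsTame v G b P) :
    ∃ y, IsLimitPair v G b y ∧
      ∀ Q : G[X], ∃ Q' : G[X], Q.eval₂ G.subtype y = Q'.eval₂ G.subtype y ∧
        (Q' = 0 ∨ IsTame v G b Q') := by
  classical
  have hvn := H.valuation_natCast
  have hinj := hG.fstHom_injective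
  have : Nontrivial G := ⟨0, 1, fun h => by
    have := congrArg (fstHom G) h
    simp at this⟩
  have hex : ∃ d, ∃ P : G[X], P.natDegree = d ∧ P ≠ 0 ∧ ¬ IsTame v G b P := by
    obtain ⟨P, h⟩ := hP
    exact ⟨_, P, rfl, h⟩
  obtain ⟨P₀, hdeg₀, hP₀, hPt₀⟩ := Nat.find_spec hex
  have hmin : ∀ Q : G[X], Q.natDegree < Nat.find hex → Q = 0 ∨ IsTame v G b Q := by
    intro Q hQ
    by_contra! h
    exact Nat.find_min hex hQ ⟨Q, rfl, h⟩
  have hlead : fstHom G P₀.leadingCoeff ≠ 0 := by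
    rw [map_ne_zero_iff _ hinj]
    simpa using hP₀
  let a : G := ⟨(P₀.leadingCoeff : K × K)⁻¹, hG.inv_mem _ P₀.leadingCoeff.2⟩
  have ha : P₀.leadingCoeff * a = 1 :=
    Subtype.ext (hG.mul_inv_cancel P₀.leadingCoeff.2 hlead)
  set P : G[X] := C a * P₀ with hPdef
  have hPP₀ : P₀ = C P₀.leadingCoeff * P := by
    rw [hPdef, ← mul_assoc, ← C_mul, ha, C_1, one_mul]
  have hmonic : P.Monic := by
    rw [Monic, hPdef, leadingCoeff_C_mul_of_isUnit
      (IsUnit.of_mul_eq_one _ (by rw [mul_comm]; exact ha)), mul_comm, ha]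
  have hdeg : P.natDegree = Nat.find hex := by
    rw [← hdeg₀, hPdef]
    refine natDegree_C_mul_of_mul_ne_zero ?_
    rw [mul_comm, ha]
    exact one_ne_zero
  have hPt : ¬ IsTame v G b P := fun h => hPt₀ (hPP₀ ▸ h.C_mul hlead)
  have hpos : 0 < P.natDegree := by
    rw [Nat.pos_iff_ne_zero]
    intro h0
    exact hPt (hG.isTame_of_natDegree_eq_zero hno hmonic.ne_zero h0)
  have hne : ∀ c : G, v (b - fstHom G c) ≠ 0 := fun c h => by
    obtain ⟨d, hd⟩ := hno c
    rw [h] at hd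
    exact absurd hd (not_lt.2 zero_le)
  have hder0 : derivative P ≠ 0 := by
    intro h0
    have := congrArg (fun Q => fstHom G (Q.coeff (P.natDegree - 1))) h0
    simp only [coeff_derivative, coeff_zero, map_zero] at this
    rw [← Nat.cast_add_one, Nat.sub_add_cancel hpos, hmonic.coeff_natDegree, one_mul,
      map_natCast] at this
    have h1 := hvn _ hpos.ne'
    simp [this] at h1
  obtain ⟨c, e, hce, hn⟩ := (hmin (derivative P)
    (hdeg ▸ natDegree_derivative_lt hpos.ne')).resolve_left hder0
  have hens : ∀ c' e' : G, v (b - fstHom G c') ≤ v (fstHom G e') →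
      v (fstHom G e') ≤ v (fstHom G e) → HenselAt v (fstHom G) P c' e' := by
    intro c' e' h1 h2
    refine henselAt_of_not_isTame H hPt h1 (fun h0 => ?_) (hn.mono hvn ?_ h2)
    · rw [h0, map_zero] at h1
      exact hne _ (le_antisymm h1 zero_le)
    · have : fstHom G c' - fstHom G c = (b - fstHom G c) - (b - fstHom G c') := by ring
      rw [this]
      exact v.map_sub_le hce (h1.trans h2)
  have hce' := hens c e hce le_rfl
  obtain ⟨z₁, hz₁, hr₁⟩ := hce'.exists_root H
  obtain ⟨z₂, hz₂, hr₂⟩ := (hG.henselAt_snd hce').exists_root H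
  have hroot : P.eval₂ G.subtype (z₁, z₂) = 0 :=
    Prod.ext ((eval₂_subtype_fst _ _).trans hr₁) ((eval₂_subtype_snd _ _).trans hr₂)
  refine ⟨(z₁, z₂), fun c' e' h => ?_, fun Q => ⟨Q %ₘ P, ?_, ?_⟩⟩
  · have hdiff : ∀ {r : G}, v (b - fstHom G c) ≤ v (fstHom G r) →
        v (b - fstHom G c') ≤ v (fstHom G r) → v (fstHom G (c - c')) ≤ v (fstHom G r) := by
      intro r hr hr'
      have : fstHom G (c - c') = (b - fstHom G c') - (b - fstHom G c) := by
        rw [map_sub]; ring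
      rw [this]
      exact v.map_sub_le hr' hr
    rcases le_total (v (fstHom G e')) (v (fstHom G e)) with hle | hle
    · have hh := hens c' e' h hle
      obtain ⟨w₁, hw₁, hs₁⟩ := hh.exists_root H
      obtain ⟨w₂, hw₂, hs₂⟩ := (hG.henselAt_snd hh).exists_root H
      have hcc : v (fstHom G (c - c')) ≤ v (fstHom G e) := hdiff hce (h.trans hle)
      have e₁ : w₁ = z₁ := by
        refine hce'.root_unique ?_ hz₁ hs₁ hr₁
        have : w₁ - fstHom G c = (w₁ - fstHom G c') - fstHom G (c - c') := by
          rw [map_sub]; ring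
        rw [this]
        exact v.map_sub_le (hw₁.trans hle) hcc
      have e₂ : w₂ = z₂ := by
        refine (hG.henselAt_snd hce').root_unique ?_ hz₂ hs₂ hr₂
        have : w₂ - sndHom G c = (w₂ - sndHom G c') - sndHom G (c - c') := by
          rw [map_sub]; ring
        rw [this]
        exact v.map_sub_le (hw₂.trans ((hG.hom_le_iff _ _).1 hle)) ((hG.hom_le_iff _ _).1 hcc)
      rw [← e₁, ← e₂]
      exact ⟨hw₁, hw₂⟩
    · have hcc : v (fstHom G (c - c')) ≤ v (fstHom G e') := hdiff (hce.trans hle) h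
      constructor
      · have : z₁ - fstHom G c' = (z₁ - fstHom G c) + fstHom G (c - c') := by
          rw [map_sub]; ring
        simp only [this]
        exact v.map_add_le (hz₁.trans hle) hcc
      · have : z₂ - sndHom G c' = (z₂ - sndHom G c) + sndHom G (c - c') := by
          rw [map_sub]; ring
        simp only [this]
        exact v.map_add_le (hz₂.trans ((hG.hom_le_iff _ _).1 hle)) ((hG.hom_le_iff _ _).1 hcc)
  · exact (eval₂_modByMonic_eq_self_of_root hroot).symm
  · refine hmin _ (hdeg ▸ natDegree_modByMonic_lt Q hmonic ?_)
    intro h1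
    rw [h1] at hpos
    simp at hpos

lemma exists_limitPair_of_countable (hG : IsPartialIso k v G) (H : IsSaturatedHenselian k v)
    (hcount : (valueSet v G).Countable) {b : K}
    (hno : ∀ c : G, ∃ d : G, v (b - fstHom G d) < v (b - fstHom G c)) :
    ∃ y, IsLimitPair v G b y := by
  obtain ⟨w, hw⟩ := hcount.exists_eq_range ⟨_, 0, G.zero_mem, rfl⟩
  have hstep : ∀ (i : ℕ) (c : G), ∃ c' : G, v (b - fstHom G c') < v (b - fstHom G c) ∧
      ((∃ d : G, v (b - fstHom G d) ≤ w i) → v (b - fstHom G c') ≤ w i) := by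
    intro i c
    by_cases h : ∃ d : G, v (b - fstHom G d) ≤ w i
    · obtain ⟨d, hd⟩ := h
      rcases le_total (v (b - fstHom G d)) (v (b - fstHom G c)) with hdc | hdc
      · obtain ⟨c', hc'⟩ := hno d
        exact ⟨c', hc'.trans_le hdc, fun _ => hc'.le.trans hd⟩
      · obtain ⟨c', hc'⟩ := hno c
        exact ⟨c', hc', fun _ => (hc'.le.trans hdc).trans hd⟩
    · obtain ⟨c', hc'⟩ := hno c
      exact ⟨c', hc', fun h' => absurd h' h⟩
  choose f hf1 hf2 using hstep
  let c : ℕ → G := fun i => Nat.rec 0 f i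
  have hlt : ∀ i, v (b - fstHom G (c (i + 1))) < v (b - fstHom G (c i)) := fun i => hf1 i (c i)
  have hanti : Antitone fun i => v (b - fstHom G (c i)) := antitone_nat_of_succ_le fun i => (hlt i).le
  have hreach : ∀ i, (∃ d : G, v (b - fstHom G d) ≤ w i) → v (b - fstHom G (c (i + 1))) ≤ w i :=
    fun i => hf2 i (c i)
  have hval : ∀ i, v (fstHom G (c (i + 1) - c i)) = v (b - fstHom G (c i)) := by
    intro i
    have : fstHom G (c (i + 1) - c i) = (b - fstHom G (c i)) - (b - fstHom G (c (i + 1))) := by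
      rw [map_sub]; ring
    rw [this]
    exact v.map_sub_eq_of_lt_left (hlt i)
  obtain ⟨b', hb'⟩ := H.exists_mem_balls (fun i => sndHom G (c (i + 1)))
    (fun i => sndHom G (c (i + 1) - c i)) fun i j hij => by
      rw [← map_sub, ← hG.hom_lt_iff, hval]
      have : fstHom G (c (j + 1) - c (i + 1)) =
          (b - fstHom G (c (i + 1))) - (b - fstHom G (c (j + 1))) := by
        rw [map_sub]; ring
      rw [this]
      exact (v.map_sub_le le_rfl (hanti (by omega : i + 1 ≤ j + 1))).trans_lt (hlt i)
  refine ⟨(b, b'), fun d e hde => ⟨hde, ?_⟩⟩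
  obtain ⟨i, hi⟩ : v (fstHom G e) ∈ Set.range w := hw ▸ ⟨e, e.2, rfl⟩
  have h1 : v (b - fstHom G (c (i + 1))) ≤ v (fstHom G e) := hi ▸ hreach i ⟨d, hi ▸ hde⟩
  have h2 : v (b' - sndHom G (c (i + 1 + 1))) ≤ v (sndHom G e) := by
    refine (hb' (i + 1)).trans ?_
    rwa [← hG.hom_le_iff, hval]
  have h3 : v (sndHom G (c (i + 1 + 1) - d)) ≤ v (sndHom G e) := by
    rw [← hG.hom_le_iff]
    have : fstHom G (c (i + 1 + 1) - d) = (b - fstHom G d) - (b - fstHom G (c (i + 1 + 1))) := by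
      rw [map_sub]; ring
    rw [this]
    exact v.map_sub_le hde ((hlt _).le.trans h1)
  have : b' - sndHom G d = (b' - sndHom G (c (i + 1 + 1))) + sndHom G (c (i + 1 + 1) - d) := by
    rw [map_sub]; ring
  simp only [this]
  exact v.map_add_le h2 h3

/-- One can adjoin an element approximating `b` without new values. -/
lemma exists_immediate_adjoin (hG : IsPartialIso k v G) (H : IsSaturatedHenselian k v)
    (hcount : (valueSet v G).Countable) {b : K}
    (hno : ∀ c : G, ∃ d : G, v (b - fstHom G d) < v (b - fstHom G c)) :
    ∃ G' : Subring (K × K), IsPartialIso k v G' ∧ G < G' ∧ valueSet v G' ⊆ valueSet v G := by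
  have : ∃ y, IsLimitPair v G b y ∧
      ∀ Q : G[X], ∃ Q' : G[X], Q.eval₂ G.subtype y = Q'.eval₂ G.subtype y ∧
        (Q' = 0 ∨ IsTame v G b Q') := by
    by_cases hP : ∃ P : G[X], P ≠ 0 ∧ ¬ IsTame v G b P
    · exact hG.exists_limitPair_of_not_isTame H hno hP
    · push Not at hP
      obtain ⟨y, hy⟩ := hG.exists_limitPair_of_countable H hcount hno
      exact ⟨y, hy, fun Q => ⟨Q, rfl, or_iff_not_imp_left.2 (hP Q)⟩⟩
  obtain ⟨y, hy, hQ⟩ := this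
  obtain ⟨G', hG', hle, hyG', hval⟩ := hG.exists_adjoin_of_isTame hy hQ
  refine ⟨G', hG', lt_of_le_of_ne hle ?_, hval⟩
  rintro rfl
  exact fst_notMem_of_isLimitPair hno hy ⟨y, hyG'⟩ rfl

/-- A maximal immediate extension: every element has a best approximation whose distance is a new
value. -/
lemma exists_maximal_immediate (hG : IsPartialIso k v G) (H : IsSaturatedHenselian k v)
    (hcount : (valueSet v G).Countable) :
    ∃ G' : Subring (K × K), IsPartialIso k v G' ∧ G ≤ G' ∧ valueSet v G' = valueSet v G ∧
      ∀ b, (∃ g ∈ G', g.1 = b) ∨ ∃ c ∈ G', v (b - c.1) ∉ valueSet v G' := by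
  obtain ⟨G', hle, hmax⟩ := zorn_le_nonempty₀
    {G' : Subring (K × K) | IsPartialIso k v G' ∧ valueSet v G' ⊆ valueSet v G} (by
      intro S hS hchain G₀ hG₀
      have hdir : DirectedOn (· ≤ ·) S := hchain.directedOn
      have hmem : ∀ x, x ∈ sSup S ↔ ∃ A ∈ S, x ∈ A := fun x =>
        Subring.mem_sSup_of_directedOn ⟨G₀, hG₀⟩ hdir
      refine ⟨sSup S, ⟨⟨?_, ?_, ?_⟩, ?_⟩, fun A hA => le_sSup hA⟩
      · intro g hg h hh
        obtain ⟨A, hA, hgA⟩ := (hmem g).1 hg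
        obtain ⟨B, hB, hhB⟩ := (hmem h).1 hh
        obtain ⟨D, hD, hAD, hBD⟩ := hdir A hA B hB
        exact (hS hD).1.le_iff g (hAD hgA) h (hBD hhB)
      · intro g hg
        obtain ⟨A, hA, hgA⟩ := (hmem g).1 hg
        exact (hmem _).2 ⟨A, hA, (hS hA).1.inv_mem g hgA⟩
      · intro s
        exact (hmem _).2 ⟨G₀, hG₀, (hS hG₀).1.const_mem s⟩
      · rintro _ ⟨g, hg, rfl⟩
        obtain ⟨A, hA, hgA⟩ := (hmem g).1 hg
        exact (hS hA).2 ⟨g, hgA, rfl⟩) G ⟨hG, subset_rfl⟩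
  obtain ⟨hG', hsub⟩ := hmax.prop
  have heq : valueSet v G' = valueSet v G := hsub.antisymm (Set.image_mono hle)
  refine ⟨G', hG', hle, heq, fun b => ?_⟩
  by_cases hno : ∀ c : G', ∃ d : G', v (b - fstHom G' d) < v (b - fstHom G' c)
  · obtain ⟨G'', hG'', hlt, hval⟩ := hG'.exists_immediate_adjoin H (heq ▸ hcount) hno
    exact absurd hlt (hmax.not_gt ⟨hG'', hval.trans hsub⟩)
  push Not at hno
  obtain ⟨c, hc⟩ := hno
  rcases eq_or_ne (b - fstHom G' c) 0 with h0 | h0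
  · exact Or.inl ⟨c, c.2, (sub_eq_zero.1 h0).symm⟩
  refine Or.inr ⟨c, c.2, ?_⟩
  rintro ⟨g, hg, hgv⟩
  have hgv : v g.1 = v (b - fstHom G' c) := hgv
  have hg0 : v g.1 ≠ 0 := by
    rw [hgv]
    simpa using h0
  have hg1 : g.1 ≠ 0 := by simpa using hg0
  obtain ⟨s, hs⟩ := H.exists_residue ((b - fstHom G' c) / g.1) (by
    rw [map_div₀, hgv, div_self (hgv ▸ hg0)])
  have h1 := hc (c + ⟨_, G'.mul_mem (hG'.const_mem s) hg⟩)
  have h2 : b - fstHom G' (c + ⟨_, G'.mul_mem (hG'.const_mem s) hg⟩) =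
      ((b - fstHom G' c) / g.1 - algebraMap k K s) * g.1 := by
    have : fstHom G' (c + ⟨_, G'.mul_mem (hG'.const_mem s) hg⟩) =
        fstHom G' c + algebraMap k K s * g.1 := by
      rw [map_add]; rfl
    rw [this]
    field_simp
    ring
  rw [h2, ← hgv, map_mul] at h1
  refine absurd h1 (not_le.2 ?_)
  exact mul_lt_of_lt_one_left (zero_lt_iff.2 hg0) hs

end IsPartialIso

end ImmediateExtension

section Systems

variable {K Γ₀ k : Type*} [Field K] [LinearOrderedCommGroupWithZero Γ₀] [Field k] [Algebra k K]
  {v : Valuation K Γ₀} {G : Subring (K × K)}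

lemma infDivisible_inv {w : K} (hw : w ∈ infDivisible K) : w⁻¹ ∈ infDivisible K := by
  intro n hn
  obtain ⟨y, rfl⟩ := hw n hn
  exact ⟨y⁻¹, inv_pow y n⟩

/-- Partial isomorphisms with countably many values, closed under roots: the ones used in the
back-and-forth argument. -/
structure IsSystem (k : Type*) [Field k] [Algebra k K] (v : Valuation K Γ₀)
    (G : Subring (K × K)) : Prop where
  isPartialIso : IsPartialIso k v G
  divisible : HasDivisibleValues v G
  countable : (valueSet v G).Countable

namespace FillsCut

lemma of_mul_pow {z : K × K} {d : ℕ} (hd : 0 < d) {s : k} (hs : v (algebraMap k K s) = 1)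
    (h : FillsCut v G ((algebraMap k K s, algebraMap k K s) * z ^ d)) : FillsCut v G z := by
  intro g hg
  have := h (g ^ d) (G.pow_mem hg d)
  simp only [Prod.fst_mul, Prod.snd_mul, Prod.pow_fst, Prod.pow_snd, map_mul, map_pow, hs,
    one_mul] at this
  simpa only [pow_lt_pow_iff_left₀ (zero_le (a := _)) (zero_le (a := _)) hd.ne'] using this

end FillsCut

lemma fillsCut_root (H : IsSaturatedHenselian k v) {y : K × K} (h1 : y.1 ≠ 0) (h2 : y.2 ≠ 0)
    (hy : y.1 / y.2 ∈ infDivisible K) {d : ℕ} (hd : 0 < d) :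
    ∃ z : K × K, (z.1 ≠ 0 ∧ z.2 ≠ 0 ∧ z.1 / z.2 ∈ infDivisible K) ∧
      ∃ s : k, v (algebraMap k K s) = 1 ∧ (algebraMap k K s, algebraMap k K s) * z ^ d = y := by
  obtain ⟨s, x, hs, hx⟩ := H.exists_const_mul_pow h1 d hd
  obtain ⟨u, hu, hud⟩ := H.exists_infDivisible_pow _ hy d hd
  have hx0 : x ≠ 0 := by
    rintro rfl
    rw [zero_pow hd.ne', mul_zero] at hx
    exact h1 hx.symm
  have hu0 : u ≠ 0 := by
    rintro rfl
    rw [zero_pow hd.ne', eq_comm, div_eq_zero_iff] at hud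
    tauto
  refine ⟨(x, x / u), ⟨hx0, div_ne_zero hx0 hu0, ?_⟩, s, H.valuation_const s hs, ?_⟩
  · simpa [div_div_cancel₀ hx0] using hu
  · ext
    · simpa using hx
    · simp only [Prod.snd_mul, Prod.pow_snd, div_pow, hud]
      rw [← mul_div_assoc, hx, div_div_cancel₀ h1]

lemma isPartialIso_iSup {ι : Type*} [Nonempty ι] {A : ι → Subring (K × K)}
    (hdir : Directed (· ≤ ·) A) (hA : ∀ i, IsPartialIso k v (A i)) :
    IsPartialIso k v (⨆ i, A i) := by
  have hmem : ∀ x, x ∈ ⨆ i, A i ↔ ∃ i, x ∈ A i := fun x => Subring.mem_iSup_of_directed hdir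
  refine ⟨fun g hg h hh => ?_, fun g hg => ?_, fun s => ?_⟩
  · obtain ⟨i, hi⟩ := (hmem g).1 hg
    obtain ⟨j, hj⟩ := (hmem h).1 hh
    obtain ⟨l, hil, hjl⟩ := hdir i j
    exact (hA l).le_iff g (hil hi) h (hjl hj)
  · obtain ⟨i, hi⟩ := (hmem g).1 hg
    exact (hmem _).2 ⟨i, (hA i).inv_mem g hi⟩
  · obtain ⟨i⟩ := ‹Nonempty ι›
    exact (hmem _).2 ⟨i, (hA i).const_mem s⟩

namespace IsSystem

/-- A pair filling a cut, whose ratio is infinitely divisible, can be adjoined to a system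
together with all its roots. -/
lemma exists_adjoin_of_fillsCut (hG : IsSystem k v G) (H : IsSaturatedHenselian k v) {y : K × K}
    (hy : FillsCut v G y) (hyG : v y.1 ∉ valueSet v G) (hdiv : y.1 / y.2 ∈ infDivisible K) :
    ∃ G' : Subring (K × K), IsSystem k v G' ∧ G ≤ G' ∧ y ∈ G' ∧
      ∀ g ∈ G', ∃ a ∈ G, ∃ (m : ℕ) (n : ℤ), 0 < m ∧ v g.1 ^ m = v a.1 * v y.1 ^ n := by
  obtain ⟨hy1, hy2⟩ := IsPartialIso.fillsCut_ne_zero hy hyG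
  let Y := {z : K × K // z.1 ≠ 0 ∧ z.2 ≠ 0 ∧ z.1 / z.2 ∈ infDivisible K}
  have hstep : ∀ (n : ℕ) (z : Y), ∃ z' : Y, ∃ s : k, v (algebraMap k K s) = 1 ∧
      (algebraMap k K s, algebraMap k K s) * z'.1 ^ (n.factorial) = z.1 := by
    intro n z
    obtain ⟨z', hz', hs⟩ := fillsCut_root H z.2.1 z.2.2.1 z.2.2.2 n.factorial_pos
    exact ⟨⟨z', hz'⟩, hs⟩
  choose f s hs hf using hstep
  let Z : ℕ → Y := fun n => Nat.rec ⟨y, hy1, hy2, hdiv⟩ f n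
  let z : ℕ → K × K := fun n => (Z n).1
  let c : ℕ → K × K := fun n => (algebraMap k K (s n (Z n)), algebraMap k K (s n (Z n)))
  have hz : ∀ n, c n * z (n + 1) ^ n.factorial = z n := fun n => hf n (Z n)
  have hcv : ∀ n, v (algebraMap k K (s n (Z n))) = 1 := fun n => hs n (Z n)
  have hzv : ∀ n, v (z (n + 1)).1 ^ n.factorial = v (z n).1 := fun n => by
    have := congrArg (fun x => v x.1) (hz n)
    simpa [c, hcv] using this
  have hz1 : ∀ n, v (z n).1 ≠ 0 := fun n => by simpa using (Z n).2.1
  have hfill : ∀ n, FillsCut v G (z n) := by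
    intro n
    induction n with
    | zero => exact hy
    | succ n ih => exact FillsCut.of_mul_pow n.factorial_pos (hcv n) ((hz n).symm ▸ ih)
  have hnot : ∀ n, v (z n).1 ∉ valueSet v G := by
    intro n
    induction n with
    | zero => exact hyG
    | succ n ih =>
      rintro ⟨g, hg, h⟩
      exact ih ⟨g ^ n.factorial, G.pow_mem hg _, by
        simpa [← hzv n] using congrArg (· ^ n.factorial) h⟩
  choose A hA hle hzA hval hmin using fun n =>
    hG.isPartialIso.exists_adjoin_of_fillsCut hG.divisible (hfill n) (hnot n)
  have hmono : Monotone A := monotone_nat_of_le_succ fun n => by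
    refine hmin n _ (hA (n + 1)) (hle _) ?_
    rw [← hz n]
    exact Subring.mul_mem _ ((hA _).const_mem _) (Subring.pow_mem _ (hzA _) _)
  have hdir : Directed (· ≤ ·) A := hmono.directed_le
  have hmem : ∀ x, x ∈ ⨆ i, A i ↔ ∃ i, x ∈ A i := fun x => Subring.mem_iSup_of_directed hdir
  have hpow : ∀ n l, ∃ q, 0 < q ∧ v (z (n + l)).1 ^ q = v (z n).1 := by
    intro n l
    induction l with
    | zero => exact ⟨1, one_pos, pow_one _⟩
    | succ l ih =>
      obtain ⟨q, hq, h⟩ := ih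
      exact ⟨(n + l).factorial * q, Nat.mul_pos (Nat.factorial_pos _) hq, by
        rw [pow_mul, ← add_assoc, hzv, h]⟩
  refine ⟨⨆ i, A i, ⟨isPartialIso_iSup hdir hA, ?_, ?_⟩, (hle 0).trans (le_iSup A 0),
    (hmem _).2 ⟨0, hzA 0⟩, ?_⟩
  · intro g hg n hn
    obtain ⟨i, hi⟩ := (hmem g).1 hg
    obtain ⟨a, ha, j, hj⟩ := hval i g hi
    obtain ⟨h, hh, hha⟩ := hG.divisible a ha n hn
    obtain ⟨q, -, hq⟩ := hpow i n
    obtain ⟨r, hr⟩ := Nat.dvd_factorial hn (Nat.le_add_left n i)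
    have hroot : (v (z (i + n + 1)).1 ^ (r * q)) ^ n = v (z i).1 := by
      rw [← hq, ← hzv, hr, ← pow_mul, ← pow_mul]
      congr 1
      ring
    have hZ := hzA (i + n + 1)
    have hzp : ∃ x ∈ A (i + n + 1), v x.1 = (v (z (i + n + 1)).1 ^ (r * q)) ^ j := by
      obtain ⟨m, rfl | rfl⟩ := j.eq_nat_or_neg
      · exact ⟨_, Subring.pow_mem _ (Subring.pow_mem _ hZ (r * q)) m, by simp⟩
      · exact ⟨_, (hA _).inv_mem _ (Subring.pow_mem _ (Subring.pow_mem _ hZ (r * q)) m), by simp⟩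
    obtain ⟨x, hx, hxv⟩ := hzp
    refine ⟨h * x, (hmem _).2 ⟨i + n + 1, Subring.mul_mem _ (hle _ hh) hx⟩, ?_⟩
    rw [Prod.fst_mul, map_mul, mul_pow, hha, hxv, hj, ← hroot, ← zpow_natCast, ← zpow_mul,
      ← zpow_natCast _ n, ← zpow_mul, mul_comm j]
  · refine ((hG.countable.prod (Set.countable_univ (α := ℕ × ℤ))).image
      fun x => x.1 * v (z x.2.1).1 ^ x.2.2).mono ?_
    rintro _ ⟨g, hg, rfl⟩
    obtain ⟨i, hi⟩ := (hmem g).1 hg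
    obtain ⟨a, ha, j, hj⟩ := hval i g hi
    exact ⟨(v a.1, i, j), ⟨⟨a, ha, rfl⟩, trivial⟩, hj.symm⟩
  · intro g hg
    obtain ⟨i, hi⟩ := (hmem g).1 hg
    obtain ⟨a, ha, j, hj⟩ := hval i g hi
    obtain ⟨q, hq, hqi⟩ := hpow 0 i
    rw [zero_add] at hqi
    refine ⟨a ^ q, G.pow_mem ha q, q, j, hq, ?_⟩
    rw [hj, mul_pow, Prod.pow_fst, map_pow]
    congr 1
    change _ = v (z 0).1 ^ j
    rw [← hqi, ← zpow_natCast, ← zpow_mul, ← zpow_natCast, ← zpow_mul, mul_comm]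

end IsSystem

lemma IsPartialIso.exists_fillsCut_mul (hG : IsPartialIso k v G) (H : IsSaturatedHenselian k v)
    (hcount : (valueSet v G).Countable) {t : K} (ht : v t ∉ valueSet v G) :
    ∃ w ∈ infDivisible K, w ≠ 0 ∧ FillsCut v G (t, t * w) := by
  classical
  have ht0 : t ≠ 0 := by
    rintro rfl
    exact ht ⟨0, G.zero_mem, rfl⟩
  have hvt : 0 < v t := by simpa [zero_lt_iff]
  obtain ⟨γ, hγ⟩ := hcount.exists_eq_range ⟨_, 0, G.zero_mem, rfl⟩
  have hrep : ∀ i, ∃ g ∈ G, v g.1 = γ i := fun i => by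
    have : γ i ∈ valueSet v G := hγ ▸ ⟨i, rfl⟩
    exact this
  choose g hg hgγ using hrep
  obtain ⟨w, hw, hw0, hwab⟩ := H.exists_infDivisible_between
    (fun i => if v (g i).1 < v t then (g i).2 / t else 0)
    (fun i => if v t < v (g i).1 then t / (g i).2 else 0) (by
      intro i j
      split_ifs with hi hj
      · have hlt := (hG.lt_iff (hg i) (hg j)).1 (hi.trans hj)
        rw [div_mul_div_cancel₀ ht0, map_div₀]
        exact (div_lt_one₀ (lt_of_le_of_lt zero_le hlt)).2 hlt
      all_goals simp)
  refine ⟨w, hw, hw0, fun x hx => ?_⟩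
  obtain ⟨i, hi⟩ : v x.1 ∈ Set.range γ := hγ ▸ ⟨x, hx, rfl⟩
  rw [← hgγ] at hi
  have hi2 := (hG.eq_iff (hg i) hx).1 hi
  have hne : v x.1 ≠ v t := fun h => ht ⟨x, hx, h⟩
  have key1 : v x.1 < v t → v x.2 < v (t * w) := by
    intro h
    have := (hwab i).1
    rw [if_pos (hi ▸ h), map_div₀, div_lt_iff₀ hvt, hi2, mul_comm] at this
    rwa [map_mul]
  have key2 : v t < v x.1 → v (t * w) < v x.2 := by
    intro h
    have hpos : 0 < v x.2 := by
      have := (hG.lt_iff G.zero_mem hx).1 (by simpa using lt_of_le_of_lt zero_le h)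
      simpa using this
    have := (hwab i).2
    rw [if_pos (hi ▸ h), map_mul, map_div₀, hi2, ← mul_div_assoc, div_lt_one₀ hpos, mul_comm]
      at this
    rwa [map_mul]
  refine ⟨⟨key2, fun h => ?_⟩, ⟨key1, fun h => ?_⟩⟩
  · rcases lt_or_gt_of_ne hne with h' | h'
    · exact absurd h (key1 h').not_gt
    · exact h'
  · rcases lt_or_gt_of_ne hne with h' | h'
    · exact h'
    · exact absurd h (key2 h').not_gt

namespace IsSystem

lemma of_valueSet_eq (hG : IsSystem k v G) {G' : Subring (K × K)} (hG' : IsPartialIso k v G')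
    (hle : G ≤ G') (hval : valueSet v G' = valueSet v G) : IsSystem k v G' := by
  refine ⟨hG', fun g hg n hn => ?_, hval ▸ hG.countable⟩
  obtain ⟨g', hg', h⟩ : v g.1 ∈ valueSet v G := hval ▸ ⟨g, hg, rfl⟩
  obtain ⟨r, hr, hrg⟩ := hG.divisible g' hg' n hn
  exact ⟨r, hle hr, hrg.trans h⟩

/-- The forth step of the back-and-forth argument. -/
lemma exists_extend_fst (hG : IsSystem k v G) (H : IsSaturatedHenselian k v) (b : K) :
    ∃ G' : Subring (K × K), IsSystem k v G' ∧ G ≤ G' ∧ ∃ y ∈ G', y.1 = b := by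
  obtain ⟨G₁, hG₁, hle, hval, hb⟩ := hG.isPartialIso.exists_maximal_immediate H hG.countable
  have hS := hG.of_valueSet_eq hG₁ hle hval
  rcases hb b with h | ⟨c, hc, ht⟩
  · exact ⟨G₁, hS, hle, h⟩
  obtain ⟨w, hw, hw0, hfill⟩ := hG₁.exists_fillsCut_mul H hS.countable ht
  have ht0 : b - c.1 ≠ 0 := (IsPartialIso.fillsCut_ne_zero hfill ht).1
  obtain ⟨G', hG', hle', hmem, -⟩ := hS.exists_adjoin_of_fillsCut H hfill ht (by
    have : (b - c.1) / ((b - c.1) * w) = w⁻¹ := by field_simp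
    simp only [this]
    exact infDivisible_inv hw)
  exact ⟨G', hG', hle.trans hle', _, G'.add_mem (hle' hc) hmem, by simp⟩

/-- Exchange of the two coordinates. -/
lemma swap (hG : IsSystem k v G) :
    IsSystem k v (G.comap (RingEquiv.prodComm : K × K ≃+* K × K).toRingHom) := by
  have hG' := hG.isPartialIso
  refine ⟨⟨fun g hg h hh => (hG'.le_iff _ hg _ hh).symm, fun g hg => hG'.inv_mem _ hg,
    fun s => hG'.const_mem s⟩, fun g hg n hn => ?_, ?_⟩
  · obtain ⟨h, hh, e⟩ := hG.divisible _ hg n hn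
    refine ⟨h.swap, hh, ?_⟩
    have := (hG'.eq_iff (G.pow_mem hh n) hg).1 (by simpa using e)
    simpa using this
  · obtain ⟨γ, hγ⟩ := hG.countable.exists_eq_range ⟨_, 0, G.zero_mem, rfl⟩
    have hrep : ∀ i, ∃ g ∈ G, v g.1 = γ i := fun i => by
      have : γ i ∈ valueSet v G := hγ ▸ ⟨i, rfl⟩
      exact this
    choose g hg hgγ using hrep
    refine (Set.countable_range fun i => v (g i).2).mono ?_
    rintro _ ⟨x, hx, rfl⟩
    obtain ⟨i, hi⟩ : v x.swap.1 ∈ Set.range γ := hγ ▸ ⟨x.swap, hx, rfl⟩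
    rw [← hgγ] at hi
    exact ⟨i, (hG'.eq_iff (hg i) hx).1 hi⟩

/-- The back step of the back-and-forth argument. -/
lemma exists_extend_snd (hG : IsSystem k v G) (H : IsSaturatedHenselian k v) (b : K) :
    ∃ G' : Subring (K × K), IsSystem k v G' ∧ G ≤ G' ∧ ∃ y ∈ G', y.2 = b := by
  obtain ⟨G', hG', hle, y, hy, hyb⟩ := hG.swap.exists_extend_fst H b
  exact ⟨_, hG'.swap, fun g hg => hle (show g.swap.swap ∈ G by simpa using hg), y.swap,
    show y.swap.swap ∈ G' by simpa using hy, hyb⟩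

end IsSystem

end Systems

section InvariantRelations

variable {K Γ₀ k : Type*} [Field K] [LinearOrderedCommGroupWithZero Γ₀] [Field k] [Algebra k K]
  {v : Valuation K Γ₀}

lemma IsSaturatedHenselian.valuation_const_eq (H : IsSaturatedHenselian k v) (s : k) :
    v (algebraMap k K s) = 0 ∨ v (algebraMap k K s) = 1 := by
  rcases eq_or_ne s 0 with rfl | hs
  · simp
  · exact Or.inr (H.valuation_const s hs)

/-- The diagonal of the constants is a system. -/
lemma isSystem_const (H : IsSaturatedHenselian k v) :
    IsSystem k v (algebraMap k (K × K)).range := by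
  refine ⟨⟨?_, ?_, fun s => ⟨s, rfl⟩⟩, ?_, ?_⟩
  · rintro _ ⟨s, rfl⟩ _ ⟨t, rfl⟩
    exact Iff.rfl
  · rintro _ ⟨s, rfl⟩
    exact ⟨s⁻¹, by ext <;> simp⟩
  · rintro _ ⟨s, rfl⟩ n hn
    rcases H.valuation_const_eq s with h | h
    · exact ⟨0, Subring.zero_mem _, by simp [hn.ne', h]⟩
    · exact ⟨1, Subring.one_mem _, by simp [h]⟩
  · refine (Set.toFinite ({0, 1} : Set Γ₀)).countable.mono ?_
    rintro _ ⟨_, ⟨s, rfl⟩, rfl⟩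
    exact H.valuation_const_eq s

/-- Infinitesimals with infinitely divisible ratio correspond under some system. -/
lemma exists_isSystem_of_infinitesimal (H : IsSaturatedHenselian k v) {x x' : K} (hx0 : x ≠ 0)
    (hx : v x < 1) (hx0' : x' ≠ 0) (hx' : v x' < 1) (hdiv : x / x' ∈ infDivisible K) :
    ∃ G : Subring (K × K), IsSystem k v G ∧ (x, x') ∈ G ∧
      ∀ g ∈ G, ∃ (m : ℕ) (n : ℤ), 0 < m ∧ (g.1 = 0 ∨ v g.1 ^ m = v x ^ n) := by
  have hvx : 0 < v x := by simpa [zero_lt_iff]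
  have hvx' : 0 < v x' := by simpa [zero_lt_iff]
  obtain ⟨G, hG, -, hmem, hval⟩ := (isSystem_const H).exists_adjoin_of_fillsCut H
    (y := (x, x')) (by
      rintro _ ⟨s, rfl⟩
      rcases H.valuation_const_eq s with h | h
      · simp [h, hx0, hx0', zero_lt_iff]
      · simp [h, hx, hx', hx.le.not_gt, hx'.le.not_gt]) (by
      rintro ⟨_, ⟨s, rfl⟩, h⟩
      rcases H.valuation_const_eq s with h' | h'
      · exact hvx.ne (h'.symm.trans h)
      · exact hx.ne' (h'.symm.trans h)) hdiv
  refine ⟨G, hG, hmem, fun g hg => ?_⟩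
  obtain ⟨_, ⟨s, rfl⟩, m, n, hm, h⟩ := hval g hg
  refine ⟨m, n, hm, ?_⟩
  rcases H.valuation_const_eq s with h' | h'
  · left
    have h'' : v ((algebraMap k (K × K)) s).1 = 0 := h'
    rw [h'', zero_mul] at h
    simpa [hm.ne'] using h
  · right
    have h'' : v ((algebraMap k (K × K)) s).1 = 1 := h'
    rwa [h'', one_mul] at h

/-- Relations preserved by systems. -/
def IsSystemInvariant (k : Type*) [Field k] [Algebra k K] (v : Valuation K Γ₀) (F : K → K → Prop) :
    Prop :=
  ∀ G : Subring (K × K), IsSystem k v G → ∀ a ∈ G, ∀ b ∈ G, F a.1 b.1 ↔ F a.2 b.2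

namespace IsSystemInvariant

variable {F : K → K → Prop}

/-- A bounded element determined by an infinitesimal `x` lies within a power of `x` of its
residue. -/
lemma exists_pow_sub_le (hF : IsSystemInvariant k v F) (H : IsSaturatedHenselian k v)
    (huniq : ∀ x y y', F x y → F x y' → y = y') {x y : K} (hxy : F x y) (hx0 : x ≠ 0)
    (hx : v x < 1) (hy : v y ≤ 1) :
    ∃ (L : k) (M : ℕ), 0 < M ∧ v (y - algebraMap k K L) < 1 ∧
      v (y - algebraMap k K L) ^ M ≤ v x := by
  have hvx : 0 < v x := by simpa [zero_lt_iff]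
  obtain ⟨G, hG, hxG, hGval⟩ := exists_isSystem_of_infinitesimal H hx0 hx hx0 hx
    (fun n hn => ⟨1, by simp [hx0]⟩)
  obtain ⟨G₁, hG₁, hle, hval, hbest⟩ := hG.isPartialIso.exists_maximal_immediate H hG.countable
  have hS := hG.of_valueSet_eq hG₁ hle hval
  have hmem : ∃ g ∈ G₁, g.1 = y := by
    refine (hbest y).resolve_right ?_
    rintro ⟨c, hc, ht⟩
    obtain ⟨w, hw, hw0, hfill⟩ := hG₁.exists_fillsCut_mul H hS.countable ht
    have ht0 : y - c.1 ≠ 0 := (IsPartialIso.fillsCut_ne_zero hfill ht).1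
    have key : ∀ u ∈ infDivisible K, v u = 1 → F x ((y - c.1) * (w * u) + c.2) := by
      intro u hu hvu
      have hu0 : u ≠ 0 := by
        rintro rfl
        simp at hvu
      have hfill' : FillsCut v G₁ (y - c.1, (y - c.1) * (w * u)) := by
        intro g hg
        simpa [hvu] using hfill g hg
      obtain ⟨G', hG', hle', hm, -⟩ := hS.exists_adjoin_of_fillsCut H hfill' ht (by
        have : (y - c.1) / ((y - c.1) * (w * u)) = w⁻¹ * u⁻¹ := by field_simp
        simp only [this]
        intro n hn
        obtain ⟨r, rfl⟩ := hw n hn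
        obtain ⟨r', rfl⟩ := hu n hn
        exact ⟨r⁻¹ * r'⁻¹, by simp [mul_pow]⟩)
      have := hF G' hG' _ (hle' (hle hxG)) _ (G'.add_mem hm (hle' hc))
      exact this.1 (by simpa using hxy)
    have h1 := key 1 (fun n _ => ⟨1, one_pow n⟩) v.map_one
    have h2 := key (1 + x) (H.one_add_mem_infDivisible hx) (v.map_one_add_of_lt hx)
    have h3 := huniq _ _ _ h1 h2
    rw [add_left_inj, mul_right_inj' ht0, mul_right_inj' hw0] at h3
    exact hx0 (by simpa using h3)
  obtain ⟨g, hg, rfl⟩ := hmem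
  obtain ⟨L, hL⟩ := H.exists_residue _ hy
  obtain ⟨g', hg', hgv⟩ : v (g.1 - algebraMap k K L) ∈ valueSet v G :=
    hval ▸ ⟨g - (algebraMap k K L, algebraMap k K L), G₁.sub_mem hg (hG₁.const_mem L), rfl⟩
  have hgv : v g'.1 = v (g.1 - algebraMap k K L) := hgv
  obtain ⟨m, n, hm, h0 | h⟩ := hGval g' hg'
  · refine ⟨L, 1, one_pos, hL, ?_⟩
    rw [← hgv, h0, map_zero, pow_one]
    exact zero_le
  · refine ⟨L, m, hm, hL, ?_⟩
    rw [hgv] at h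
    rw [h]
    have hlt : v x ^ n < 1 := h ▸ pow_lt_one₀ zero_le hL hm.ne'
    have hn : 0 < n := by
      by_contra! hn
      refine absurd hlt (not_lt.2 ?_)
      exact one_le_zpow_of_nonpos₀ hvx hx.le hn
    simpa using zpow_le_zpow_right_of_le_one₀ hvx hx.le hn

lemma pow_sub_le (hF : IsSystemInvariant k v F) (H : IsSaturatedHenselian k v)
    (huniq : ∀ x y y', F x y → F x y' → y = y') {x y x' y' : K} (hxy : F x y) (hxy' : F x' y')
    (hx0 : x ≠ 0) (hx : v x < 1) (hx0' : x' ≠ 0) (hx' : v x' < 1)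
    (hdiv : x / x' ∈ infDivisible K) {L : k} {M : ℕ}
    (hM : v (y - algebraMap k K L) ^ M ≤ v x) : v (y' - algebraMap k K L) ^ M ≤ v x' := by
  obtain ⟨G, hG, hxG, -⟩ := exists_isSystem_of_infinitesimal H hx0 hx hx0' hx' hdiv
  obtain ⟨G', hG', hle, g, hg, rfl⟩ := hG.exists_extend_fst H y
  have h := (hF G' hG' _ (hle hxG) _ hg).1 hxy
  rw [huniq _ _ _ hxy' h]
  have := hG'.isPartialIso.le_iff _ (G'.pow_mem (G'.sub_mem hg
    (hG'.isPartialIso.const_mem L)) M) _ (hle hxG)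
  simp only [Prod.pow_fst, Prod.pow_snd, map_pow] at this
  exact this.1 hM

end IsSystemInvariant

end InvariantRelations

section PadicGerm

/-- The ultrapower of `ℚ_[p]` over a nonprincipal ultrafilter on `ℕ`. -/
abbrev PadicGerm (p : ℕ) [Fact p.Prime] : Type := (hyperfilter ℕ : Filter ℕ).Germ ℚ_[p]

variable {p : ℕ} [Fact p.Prime]

noncomputable instance : Algebra ℚ_[p] (PadicGerm p) :=
  ((Germ.coeRingHom (hyperfilter ℕ : Filter ℕ)).comp (Pi.constRingHom ℕ ℚ_[p])).toAlgebra

namespace PadicGerm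

/-- The germ of a sequence. -/
noncomputable def mk (f : ℕ → ℚ_[p]) : PadicGerm p := (f : (hyperfilter ℕ : Filter ℕ).Germ ℚ_[p])

lemma exists_mk (z : PadicGerm p) : ∃ f, mk f = z := Quotient.exists_rep z

lemma mk_eq_mk {f g : ℕ → ℚ_[p]} : mk f = mk g ↔ ∀ᶠ k in hyperfilter ℕ, f k = g k :=
  Germ.coe_eq

lemma mk_add (f g : ℕ → ℚ_[p]) : mk f + mk g = mk (fun k => f k + g k) := rfl

lemma mk_sub (f g : ℕ → ℚ_[p]) : mk f - mk g = mk (fun k => f k - g k) := rfl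

lemma mk_mul (f g : ℕ → ℚ_[p]) : mk f * mk g = mk (fun k => f k * g k) := rfl

lemma mk_neg (f : ℕ → ℚ_[p]) : - mk f = mk (fun k => - f k) := rfl

lemma mk_pow (f : ℕ → ℚ_[p]) (n : ℕ) : mk f ^ n = mk (fun k => f k ^ n) := rfl

lemma mk_inv (f : ℕ → ℚ_[p]) : (mk f)⁻¹ = mk (fun k => (f k)⁻¹) := rfl

lemma mk_div (f g : ℕ → ℚ_[p]) : mk f / mk g = mk (fun k => f k / g k) := rfl

lemma mk_zero : mk (fun _ => (0 : ℚ_[p])) = 0 := rfl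

lemma mk_one : mk (fun _ => (1 : ℚ_[p])) = 1 := rfl

lemma algebraMap_eq (s : ℚ_[p]) : algebraMap ℚ_[p] (PadicGerm p) s = mk fun _ => s := rfl

lemma mk_sum {ι : Type*} (t : Finset ι) (f : ι → ℕ → ℚ_[p]) :
    ∑ i ∈ t, mk (f i) = mk (fun k => ∑ i ∈ t, f i k) := by
  have h := map_sum (Germ.coeRingHom (R := ℚ_[p]) (hyperfilter ℕ : Filter ℕ)) f t
  have h' : (fun k => ∑ i ∈ t, f i k) = ∑ i ∈ t, f i := by
    ext k
    simp
  rw [h']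
  exact h.symm

lemma mk_ne_zero {f : ℕ → ℚ_[p]} : mk f ≠ 0 ↔ ∀ᶠ k in hyperfilter ℕ, f k ≠ 0 := by
  rw [← mk_zero, Ne, mk_eq_mk, ← Ultrafilter.eventually_not]

/-- The bounded germs. -/
def bounded (p : ℕ) [Fact p.Prime] : ValuationSubring (PadicGerm p) where
  carrier := {z | ∃ f, mk f = z ∧ ∃ M : ℝ, ∀ᶠ k in hyperfilter ℕ, ‖f k‖ ≤ M}
  mul_mem' := by
    rintro _ _ ⟨f, rfl, M, hf⟩ ⟨g, rfl, N, hg⟩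
    refine ⟨_, (mk_mul f g).symm, M * N, ?_⟩
    filter_upwards [hf, hg] with k h1 h2
    rw [norm_mul]
    exact mul_le_mul h1 h2 (norm_nonneg _) ((norm_nonneg _).trans h1)
  one_mem' := ⟨_, mk_one, 1, by simp⟩
  add_mem' := by
    rintro _ _ ⟨f, rfl, M, hf⟩ ⟨g, rfl, N, hg⟩
    refine ⟨_, (mk_add f g).symm, M + N, ?_⟩
    filter_upwards [hf, hg] with k h1 h2
    exact (norm_add_le _ _).trans (add_le_add h1 h2)
  zero_mem' := ⟨_, mk_zero, 0, by simp⟩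
  neg_mem' := by
    rintro _ ⟨f, rfl, M, hf⟩
    exact ⟨_, (mk_neg f).symm, M, by simpa using hf⟩
  mem_or_inv_mem' z := by
    obtain ⟨f, rfl⟩ := exists_mk z
    by_cases h : ∀ᶠ k in hyperfilter ℕ, ‖f k‖ ≤ 1
    · exact Or.inl ⟨f, rfl, 1, h⟩
    · refine Or.inr ⟨_, (mk_inv f).symm, 1, ?_⟩
      rw [← Ultrafilter.eventually_not] at h
      filter_upwards [h] with k hk
      rw [norm_inv]
      exact inv_le_one_of_one_le₀ (not_le.1 hk).le

/-- The coarse valuation on the ultrapower, whose valuation ring consists of the bounded germs. -/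
noncomputable abbrev val (p : ℕ) [Fact p.Prime] :
    Valuation (PadicGerm p) (bounded p).ValueGroup := (bounded p).valuation

lemma val_mk_le_iff {f g : ℕ → ℚ_[p]} :
    val p (mk f) ≤ val p (mk g) ↔ ∃ M : ℝ, ∀ᶠ k in hyperfilter ℕ, ‖f k‖ ≤ M * ‖g k‖ := by
  rw [ValuationSubring.valuation_le_iff]
  constructor
  · rintro ⟨⟨_, h, rfl, M, hM⟩, he⟩
    rw [mk_mul, mk_eq_mk] at he
    refine ⟨M, ?_⟩
    filter_upwards [hM, he] with k h1 h2
    rw [← h2, norm_mul]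
    gcongr
  · rintro ⟨M, hM⟩
    refine ⟨⟨mk f / mk g, _, (mk_div f g).symm, |M|, ?_⟩, ?_⟩
    · filter_upwards [hM] with k hk
      rw [norm_div]
      exact div_le_of_le_mul₀ (norm_nonneg _) (abs_nonneg _)
        (hk.trans (mul_le_mul_of_nonneg_right (le_abs_self M) (norm_nonneg _)))
    · change mk f / mk g * mk g = mk f
      rw [mk_div, mk_mul, mk_eq_mk]
      filter_upwards [hM] with k hk
      rcases eq_or_ne (g k) 0 with h0 | h0
      · rw [h0, norm_zero, mul_zero, norm_le_zero_iff] at hk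
        simp [h0, hk]
      · field_simp

lemma val_mk_lt_iff {f g : ℕ → ℚ_[p]} :
    val p (mk f) < val p (mk g) ↔ ∀ M : ℝ, ∀ᶠ k in hyperfilter ℕ, M * ‖f k‖ < ‖g k‖ := by
  rw [← not_le, val_mk_le_iff, not_exists]
  simp only [← Ultrafilter.eventually_not, not_le]

lemma val_mk_le_one_iff {f : ℕ → ℚ_[p]} :
    val p (mk f) ≤ 1 ↔ ∃ M : ℝ, ∀ᶠ k in hyperfilter ℕ, ‖f k‖ ≤ M := by
  rw [← map_one (val p), ← mk_one, val_mk_le_iff]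
  simp

lemma val_mk_lt_one_iff {f : ℕ → ℚ_[p]} :
    val p (mk f) < 1 ↔ ∀ M : ℝ, ∀ᶠ k in hyperfilter ℕ, M * ‖f k‖ < 1 := by
  rw [← map_one (val p), ← mk_one, val_mk_lt_iff]
  simp

lemma mk_mem_infDivisible {f : ℕ → ℚ_[p]} : mk f ∈ infDivisible (PadicGerm p) ↔
    ∀ n : ℕ, 0 < n → ∀ᶠ k in hyperfilter ℕ, ∃ y, y ^ n = f k := by
  refine forall₂_congr fun n hn => ⟨?_, fun h => ?_⟩
  · rintro ⟨y, hy⟩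
    obtain ⟨g, rfl⟩ := exists_mk y
    rw [mk_pow, mk_eq_mk] at hy
    exact hy.mono fun k hk => ⟨_, hk⟩
  · choose! y hy using fun k (hk : ∃ y, y ^ n = f k) => hk
    exact ⟨mk y, by rw [mk_pow, mk_eq_mk]; exact h.mono hy⟩

/-- Countable saturation for decreasing sequences of sets. -/
lemma exists_forall_eventually_mem {Φ : ℕ → ℕ → Set ℚ_[p]} (hanti : ∀ k, Antitone fun N => Φ N k)
    (h : ∀ N, ∀ᶠ k in hyperfilter ℕ, (Φ N k).Nonempty) :
    ∃ z : ℕ → ℚ_[p], ∀ N, ∀ᶠ k in hyperfilter ℕ, z k ∈ Φ N k := by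
  classical
  have hz : ∀ k, ∃ z, (∃ N, N ≤ k ∧ (Φ N k).Nonempty) →
      z ∈ Φ (Nat.findGreatest (fun N => (Φ N k).Nonempty) k) k := by
    intro k
    by_cases hk : ∃ N, N ≤ k ∧ (Φ N k).Nonempty
    · obtain ⟨N, hN, hne⟩ := hk
      obtain ⟨z, hz⟩ := Nat.findGreatest_spec (P := fun N => (Φ N k).Nonempty) hN hne
      exact ⟨z, fun _ => hz⟩
    · exact ⟨0, fun h => absurd h hk⟩
  choose z hz using hz
  refine ⟨z, fun N => ?_⟩
  have hge : ∀ᶠ k in hyperfilter ℕ, N ≤ k := by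
    have : ∀ᶠ k in atTop, N ≤ k := eventually_ge_atTop N
    exact Nat.hyperfilter_le_atTop this
  filter_upwards [h N, hge] with k hk hN
  exact hanti k (Nat.le_findGreatest hN hk) (hz k ⟨N, hN, hk⟩)

end PadicGerm

end PadicGerm

section PadicGermSaturated

variable {p : ℕ} [Fact p.Prime]

/-- Hensel's lemma for the sum `∑ c i * x ^ i` on a ball of radius `p ^ A`. -/
lemma padic_exists_root (N A : ℕ) (c : ℕ → ℚ_[p]) (h0 : ‖c 0‖ < (p : ℝ) ^ A) (h1 : c 1 = 1)
    (h2 : ∀ i, 2 ≤ i → i < N + 2 → ‖c i‖ * (p : ℝ) ^ (A * i) ≤ 1) :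
    ∃ x, ‖x‖ ≤ (p : ℝ) ^ A ∧ ∑ i ∈ Finset.range (N + 2), c i * x ^ i = 0 := by
  have hp : (0 : ℝ) < p := by exact_mod_cast (Fact.out : p.Prime).pos
  have hp1 : (1 : ℝ) ≤ p := by exact_mod_cast (Fact.out : p.Prime).one_le
  have hpK : (p : ℚ_[p]) ≠ 0 := by exact_mod_cast (Fact.out : p.Prime).ne_zero
  set q : ℚ_[p] := (p : ℚ_[p]) ^ A with hq
  have hqn : ‖q‖ = ((p : ℝ) ^ A)⁻¹ := by
    rw [hq, norm_pow, Padic.norm_p, inv_pow]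
  have hq0 : q ≠ 0 := pow_ne_zero _ hpK
  clear_value q
  have hd : ∀ i, ∃ d : ℤ_[p], i < N + 2 → (d : ℚ_[p]) = q * (c i * (q⁻¹) ^ i) := by
    intro i
    by_cases hi : i < N + 2
    · have hle : ‖q * (c i * (q⁻¹) ^ i)‖ ≤ 1 := by
        rw [norm_mul, norm_mul, norm_pow, norm_inv, hqn, inv_inv]
        rcases Nat.lt_or_ge i 2 with h | h
        · interval_cases i
          · rw [pow_zero, mul_one, inv_mul_le_iff₀ (by positivity), mul_one]
            exact h0.le
          · rw [h1, norm_one, one_mul, pow_one, inv_mul_cancel₀ (by positivity)]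
        · rw [← pow_mul]
          refine mul_le_one₀ ?_ (by positivity) (h2 i h hi)
          exact inv_le_one_of_one_le₀ (one_le_pow₀ hp1)
      exact ⟨⟨_, hle⟩, fun _ => rfl⟩
    · exact ⟨0, fun h => absurd h hi⟩
  choose d hd using hd
  let F : Polynomial ℤ_[p] :=
    ∑ i ∈ Finset.range (N + 2), Polynomial.C (d i) * Polynomial.X ^ i
  have hcoeff : ∀ i, i < N + 2 → F.coeff i = d i := by
    intro i hi
    simp only [F, Polynomial.finsetSum_coeff, Polynomial.coeff_C_mul_X_pow]
    rw [Finset.sum_ite_eq, if_pos (Finset.mem_range.2 hi)]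
  have hF0 : F.eval 0 = d 0 := by
    rw [← Polynomial.coeff_zero_eq_eval_zero, hcoeff 0 (by omega)]
  have hd1 : d 1 = 1 := by
    apply Subtype.ext
    rw [hd 1 (by omega), h1]
    simp [hq0]
  have hF1 : F.derivative.eval 0 = 1 := by
    rw [← Polynomial.coeff_zero_eq_eval_zero, Polynomial.coeff_derivative, hcoeff _ (by omega), hd1]
    simp
  obtain ⟨z, hz, -⟩ := hensels_lemma (R := ℤ_[p]) (F := F) (a := 0) (by
    rw [Polynomial.coe_aeval_eq_eval, hF0, hF1, norm_one, one_pow, ← PadicInt.padic_norm_e_of_padicInt,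
      hd 0 (by omega), pow_zero, mul_one, norm_mul, hqn, inv_mul_lt_iff₀ (by positivity), mul_one]
    exact h0)
  refine ⟨q⁻¹ * z, ?_, ?_⟩
  · rw [norm_mul, norm_inv, hqn, inv_inv]
    exact mul_le_of_le_one_right (by positivity) z.2
  · rw [Polynomial.coe_aeval_eq_eval, Polynomial.eval_finsetSum] at hz
    have hz' := congrArg (fun x : ℤ_[p] => (x : ℚ_[p])) hz
    simp only [Polynomial.eval_mul, Polynomial.eval_C, Polynomial.eval_pow, Polynomial.eval_X,
      PadicInt.coe_sum, PadicInt.coe_mul, PadicInt.coe_pow, PadicInt.coe_zero] at hz'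
    apply mul_left_cancel₀ hq0
    rw [mul_zero, ← hz', Finset.mul_sum]
    refine Finset.sum_congr rfl fun i hi => ?_
    rw [hd i (Finset.mem_range.1 hi)]
    ring

lemma padic_exists_pow_norm (n : ℕ) (hn : 0 < n) (x : ℚ_[p]) (hx : x ≠ 0) :
    ∃ y : ℚ_[p], ‖y ^ n‖ ≤ ‖x‖ ∧ ‖x‖ ≤ (p : ℝ) ^ n * ‖y ^ n‖ := by
  have hp1 : (1 : ℝ) < p := by exact_mod_cast (Fact.out : p.Prime).one_lt
  obtain ⟨l, hl1, hl2⟩ := exists_mem_Ico_zpow (norm_pos_iff.2 hx)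
    (one_lt_pow₀ hp1 hn.ne')
  refine ⟨(p : ℚ_[p]) ^ (-l), ?_⟩
  have : ‖((p : ℚ_[p]) ^ (-l)) ^ n‖ = ((p : ℝ) ^ n) ^ l := by
    rw [norm_pow, Padic.norm_p_zpow, neg_neg, ← zpow_natCast, ← zpow_mul, ← zpow_natCast,
      ← zpow_mul, mul_comm]
  rw [this]
  refine ⟨hl1, ?_⟩
  rw [← zpow_one_add₀ (by positivity), add_comm]
  exact hl2.le

lemma padic_exists_pow_between (D : ℕ) (hD : 0 < D) {A B : ℝ} (hA : 0 ≤ A) (hB : 0 ≤ B)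
    (h : (p : ℝ) ^ D * A * B < 1) :
    ∃ y : ℚ_[p], y ≠ 0 ∧ A < ‖y ^ D‖ ∧ B * ‖y ^ D‖ < 1 := by
  have hp1 : (1 : ℝ) < p := by exact_mod_cast (Fact.out : p.Prime).one_lt
  have hp0 : (p : ℚ_[p]) ≠ 0 := by exact_mod_cast (Fact.out : p.Prime).ne_zero
  set q : ℝ := (p : ℝ) ^ D with hq
  have hq1 : 1 < q := one_lt_pow₀ hp1 hD.ne'
  obtain ⟨x, hx0, hAx, hBx⟩ : ∃ x : ℝ, 0 < x ∧ A ≤ x ∧ q * x * B < 1 := by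
    rcases hA.eq_or_lt with rfl | hA
    · refine ⟨(q * (1 + B))⁻¹, by positivity, by positivity, ?_⟩
      rw [mul_inv, ← mul_assoc, mul_inv_cancel₀ (by positivity), one_mul,
        inv_mul_lt_iff₀ (by positivity)]
      linarith
    · exact ⟨A, hA, le_rfl, h⟩
  obtain ⟨l, hl1, hl2⟩ := exists_mem_Ico_zpow hx0 hq1
  refine ⟨(p : ℚ_[p]) ^ (-(l + 1)), zpow_ne_zero _ hp0, ?_⟩
  have : ‖((p : ℚ_[p]) ^ (-(l + 1))) ^ D‖ = q ^ (l + 1) := by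
    rw [norm_pow, Padic.norm_p_zpow, neg_neg, hq, ← zpow_natCast, ← zpow_mul, ← zpow_natCast,
      ← zpow_mul, mul_comm]
  rw [this]
  refine ⟨hAx.trans_lt hl2, lt_of_le_of_lt ?_ hBx⟩
  rw [zpow_add_one₀ (by positivity)]
  calc B * (q ^ l * q) ≤ B * (x * q) := by gcongr
    _ = q * x * B := by ring

namespace PadicGerm

lemma exists_residue (z : PadicGerm p) (hz : val p z ≤ 1) :
    ∃ s : ℚ_[p], val p (z - algebraMap ℚ_[p] (PadicGerm p) s) < 1 := by
  obtain ⟨f, rfl⟩ := exists_mk z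
  obtain ⟨M, hM⟩ := val_mk_le_one_iff.1 hz
  obtain ⟨s, -, hs⟩ := (isCompact_closedBall (0 : ℚ_[p]) M).ultrafilter_le_nhds
    ((hyperfilter ℕ).map f) (by
      rw [le_principal_iff]
      change ∀ᶠ k in hyperfilter ℕ, f k ∈ Metric.closedBall 0 M
      filter_upwards [hM] with k hk
      simpa using hk)
  refine ⟨s, ?_⟩
  rw [algebraMap_eq, mk_sub, val_mk_lt_one_iff]
  intro L
  have ht : Tendsto f (hyperfilter ℕ) (𝓝 s) := hs
  have := ht.sub_const s |>.norm.const_mul L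
  rw [sub_self, norm_zero, mul_zero] at this
  exact this.eventually (gt_mem_nhds one_pos)

lemma exists_root (P : Polynomial (PadicGerm p)) (h0 : val p (P.coeff 0) ≤ 1) (h1 : P.coeff 1 = 1)
    (h2 : ∀ i, 2 ≤ i → val p (P.coeff i) < 1) : ∃ z, val p z ≤ 1 ∧ P.eval z = 0 := by
  have hp1 : (1 : ℝ) < p := by exact_mod_cast (Fact.out : p.Prime).one_lt
  choose c hc using fun i => exists_mk (P.coeff i)
  obtain ⟨M, hM⟩ := val_mk_le_one_iff.1 (hc 0 ▸ h0)
  obtain ⟨A, hA⟩ := pow_unbounded_of_one_lt M hp1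
  have hev1 : ∀ᶠ k in hyperfilter ℕ, c 1 k = 1 := by
    rw [← mk_eq_mk, hc, h1, mk_one]
  set N := P.natDegree
  have hev2 : ∀ᶠ k in hyperfilter ℕ, ∀ i ∈ Finset.range (N + 2), 2 ≤ i →
      ‖c i k‖ * (p : ℝ) ^ (A * i) ≤ 1 := by
    rw [Filter.eventually_all_finset]
    intro i _
    by_cases hi : 2 ≤ i
    · filter_upwards [val_mk_lt_one_iff.1 ((hc i).symm ▸ h2 i hi) ((p : ℝ) ^ (A * i))] with k hk _
      rw [mul_comm]
      exact hk.le
    · exact Eventually.of_forall fun k h => absurd h hi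
  have hroot : ∀ᶠ k in hyperfilter ℕ, ∃ x, ‖x‖ ≤ (p : ℝ) ^ A ∧
      ∑ i ∈ Finset.range (N + 2), c i k * x ^ i = 0 := by
    filter_upwards [hM, hev1, hev2] with k hk0 hk1 hk2
    exact padic_exists_root N A (fun i => c i k) (hk0.trans_lt hA) hk1
      fun i hi hiN => hk2 i (Finset.mem_range.2 hiN) hi
  choose! x hx using fun k (hk : ∃ x, ‖x‖ ≤ (p : ℝ) ^ A ∧
      ∑ i ∈ Finset.range (N + 2), c i k * x ^ i = 0) => hk
  refine ⟨mk x, val_mk_le_one_iff.2 ⟨_, hroot.mono fun k hk => (hx k hk).1⟩, ?_⟩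
  rw [Polynomial.eval_eq_sum_range' (show P.natDegree < N + 2 by omega)]
  simp only [← hc, mk_pow, mk_mul]
  rw [mk_sum, ← mk_zero, mk_eq_mk]
  exact hroot.mono fun k hk => (hx k hk).2

lemma exists_val_pow (z : PadicGerm p) (n : ℕ) (hn : 0 < n) : ∃ y, val p (y ^ n) = val p z := by
  obtain ⟨f, rfl⟩ := exists_mk z
  by_cases hz : mk f = 0
  · exact ⟨0, by rw [hz, zero_pow hn.ne']⟩
  have hf := mk_ne_zero.1 hz
  choose! y hy1 hy2 using padic_exists_pow_norm (p := p) n hn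
  refine ⟨mk fun k => y (f k), ?_⟩
  rw [mk_pow]
  apply le_antisymm
  · refine val_mk_le_iff.2 ⟨1, ?_⟩
    filter_upwards [hf] with k hk
    rw [one_mul]
    exact hy1 _ hk
  · refine val_mk_le_iff.2 ⟨(p : ℝ) ^ n, ?_⟩
    filter_upwards [hf] with k hk
    exact hy2 _ hk

lemma exists_infDivisible_pow (w : PadicGerm p) (hw : w ∈ infDivisible (PadicGerm p)) (n : ℕ)
    (hn : 0 < n) : ∃ u ∈ infDivisible (PadicGerm p), u ^ n = w := by
  obtain ⟨f, rfl⟩ := exists_mk w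
  rw [mk_mem_infDivisible] at hw
  obtain ⟨u, hu⟩ := exists_forall_eventually_mem (p := p)
    (Φ := fun N k => {u | u ^ n = f k ∧ ∀ i, 0 < i → i ≤ N → ∃ r, r ^ i = u})
    (fun k N N' hNN' u hu => ⟨hu.1, fun i hi hiN => hu.2 i hi (hiN.trans hNN')⟩) (by
      intro N
      filter_upwards [hw (N.factorial * n) (Nat.mul_pos N.factorial_pos hn)] with k ⟨y, hy⟩
      refine ⟨y ^ N.factorial, by rw [← pow_mul, hy], fun i hi hiN => ?_⟩
      obtain ⟨r, hr⟩ := Nat.dvd_factorial hi hiN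
      exact ⟨y ^ r, by rw [hr, mul_comm i, pow_mul]⟩)
  refine ⟨mk u, mk_mem_infDivisible.2 fun i hi => ?_, ?_⟩
  · exact (hu i).mono fun k hk => hk.2 i hi le_rfl
  · rw [mk_pow, mk_eq_mk]
    exact (hu 0).mono fun k hk => hk.1

lemma exists_infDivisible_between (a b : ℕ → PadicGerm p) (hab : ∀ i j, val p (a i * b j) < 1) :
    ∃ w ∈ infDivisible (PadicGerm p), w ≠ 0 ∧ ∀ i, val p (a i) < val p w ∧ val p (w * b i) < 1 := by
  choose α hα using fun i => exists_mk (a i)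
  choose β hβ using fun i => exists_mk (b i)
  simp only [← hα, ← hβ, mk_mul, val_mk_lt_one_iff] at hab ⊢
  obtain ⟨w, hw⟩ := exists_forall_eventually_mem (p := p)
    (Φ := fun N k => {w | w ≠ 0 ∧ ∀ i, i ≤ N → (0 < i → ∃ r, r ^ i = w) ∧
      (N : ℝ) * ‖α i k‖ < ‖w‖ ∧ (N : ℝ) * ‖w * β i k‖ < 1})
    (fun k N N' hNN' w hw => ⟨hw.1, fun i hiN => by
      have hN : (N : ℝ) ≤ N' := by exact_mod_cast hNN'
      obtain ⟨h1, h2, h3⟩ := hw.2 i (hiN.trans hNN')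
      exact ⟨h1, lt_of_le_of_lt (by gcongr) h2, lt_of_le_of_lt (by gcongr) h3⟩⟩) (by
      intro N
      have hall : ∀ᶠ k in hyperfilter ℕ, ∀ i ∈ Finset.range (N + 1), ∀ j ∈ Finset.range (N + 1),
          (p : ℝ) ^ N.factorial * N * N * ‖α i k * β j k‖ < 1 := by
        rw [Filter.eventually_all_finset]
        intro i _
        rw [Filter.eventually_all_finset]
        intro j _
        exact hab i j _
      filter_upwards [hall] with k hk
      have hne : (Finset.range (N + 1)).Nonempty := ⟨0, by simp⟩
      obtain ⟨i, hi, himax⟩ := Finset.exists_max_image _ (fun i => ‖α i k‖) hne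
      obtain ⟨j, hj, hjmax⟩ := Finset.exists_max_image _ (fun i => ‖β i k‖) hne
      obtain ⟨y, hy0, hy1, hy2⟩ := padic_exists_pow_between (p := p) N.factorial N.factorial_pos
        (A := N * ‖α i k‖) (B := N * ‖β j k‖) (by positivity) (by positivity) (by
          have := hk i hi j hj
          rw [norm_mul] at this
          linarith)
      refine ⟨y ^ N.factorial, pow_ne_zero _ hy0, fun i' hi' => ⟨fun hpos => ?_, ?_, ?_⟩⟩
      · obtain ⟨r, hr⟩ := Nat.dvd_factorial hpos hi'
        exact ⟨y ^ r, by rw [hr, mul_comm i', pow_mul]⟩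
      · refine lt_of_le_of_lt ?_ hy1
        gcongr
        exact himax i' (Finset.mem_range.2 (by omega))
      · refine lt_of_le_of_lt ?_ hy2
        rw [norm_mul, mul_comm ‖y ^ N.factorial‖, ← mul_assoc]
        gcongr
        exact hjmax i' (Finset.mem_range.2 (by omega)))
  refine ⟨mk w, mk_mem_infDivisible.2 fun n hn => ?_, mk_ne_zero.2 ((hw 0).mono fun k hk => hk.1),
    fun i => ⟨val_mk_lt_iff.2 fun M => ?_, ?_⟩⟩
  · exact (hw n).mono fun k hk => (hk.2 n le_rfl).1 hn
  · obtain ⟨N, hN⟩ := exists_nat_ge M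
    filter_upwards [hw (max N i)] with k hk
    refine lt_of_le_of_lt ?_ (hk.2 i (le_max_right _ _)).2.1
    gcongr
    exact hN.trans (by exact_mod_cast le_max_left N i)
  · rw [mk_mul, val_mk_lt_one_iff]
    intro M
    obtain ⟨N, hN⟩ := exists_nat_ge M
    filter_upwards [hw (max N i)] with k hk
    refine lt_of_le_of_lt ?_ (hk.2 i (le_max_right _ _)).2.2
    gcongr
    exact hN.trans (by exact_mod_cast le_max_left N i)

lemma exists_mem_balls (c e : ℕ → PadicGerm p)
    (hce : ∀ i j, i ≤ j → val p (c j - c i) < val p (e i)) :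
    ∃ b, ∀ i, val p (b - c i) ≤ val p (e i) := by
  choose γ hγ using fun i => exists_mk (c i)
  choose η hη using fun i => exists_mk (e i)
  simp only [← hγ, ← hη, mk_sub, val_mk_lt_iff] at hce ⊢
  obtain ⟨b, hb⟩ := exists_forall_eventually_mem (p := p)
    (Φ := fun N k => {b | ∀ i, i ≤ N → ‖b - γ i k‖ ≤ ‖η i k‖})
    (fun k N N' hNN' b hb i hi => hb i (hi.trans hNN')) (by
      intro N
      have hall : ∀ᶠ k in hyperfilter ℕ, ∀ i ∈ Finset.range (N + 1),
          ‖γ N k - γ i k‖ ≤ ‖η i k‖ := by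
        rw [Filter.eventually_all_finset]
        intro i hi
        filter_upwards [hce i N (Nat.lt_succ_iff.1 (Finset.mem_range.1 hi)) 1] with k hk
        rw [one_mul] at hk
        exact hk.le
      filter_upwards [hall] with k hk
      exact ⟨γ N k, fun i hi => hk i (Finset.mem_range.2 (by omega))⟩)
  refine ⟨mk b, fun i => ?_⟩
  rw [mk_sub, val_mk_le_iff]
  refine ⟨1, (hb i).mono fun k hk => ?_⟩
  rw [one_mul]
  exact hk i le_rfl

theorem isSaturatedHenselian : IsSaturatedHenselian ℚ_[p] (val p) where
  charZero := inferInstance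
  valuation_const s hs := by
    apply le_antisymm
    · exact val_mk_le_one_iff.2 ⟨‖s‖, Eventually.of_forall fun _ => le_rfl⟩
    · rw [← map_one (val p), ← mk_one, algebraMap_eq, val_mk_le_iff]
      refine ⟨‖s‖⁻¹, Eventually.of_forall fun _ => ?_⟩
      rw [inv_mul_cancel₀ (norm_ne_zero_iff.2 hs), norm_one]
  exists_residue := exists_residue
  exists_root := exists_root
  exists_valuation_pow := exists_val_pow
  exists_infDivisible_pow := exists_infDivisible_pow
  exists_infDivisible_between := exists_infDivisible_between
  exists_mem_balls := exists_mem_balls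

end PadicGerm

end PadicGermSaturated

section Transfer

variable {p : ℕ} [Fact p.Prime]

namespace PadicGerm

lemma mk_realize_mem {G : Subring (PadicGerm p × PadicGerm p)} {β : Type*}
    {v w : β → ℕ → ℚ_[p]} (h : ∀ i, (mk (v i), mk (w i)) ∈ G) (t : Language.ring.Term β) :
    (mk fun k => t.realize fun i => v i k, mk fun k => t.realize fun i => w i k) ∈ G := by
  induction t with
  | var i => exact h i
  | func f ts ih =>
    cases f with
    | add => exact G.add_mem (ih 0) (ih 1)
    | mul => exact G.mul_mem (ih 0) (ih 1)
    | neg => exact G.neg_mem (ih 0)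
    | zero => exact G.zero_mem
    | one => exact G.one_mem

/-- Systems of partial isomorphisms of the ultrapower preserve all first-order formulas. -/
theorem eventually_realize_iff {α : Type*} {v w : α → ℕ → ℚ_[p]} {n : ℕ}
    (φ : Language.ring.BoundedFormula α n) {xs ys : Fin n → ℕ → ℚ_[p]}
    {G : Subring (PadicGerm p × PadicGerm p)} (hG : IsSystem ℚ_[p] (val p) G)
    (hv : ∀ i, (mk (v i), mk (w i)) ∈ G) (hx : ∀ j, (mk (xs j), mk (ys j)) ∈ G) :
    (∀ᶠ k in hyperfilter ℕ, φ.Realize (fun i => v i k) fun j => xs j k) ↔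
      ∀ᶠ k in hyperfilter ℕ, φ.Realize (fun i => w i k) fun j => ys j k := by
  induction φ generalizing G with
  | falsum => rfl
  | equal t₁ t₂ =>
    have hsum : ∀ i, (mk (Sum.elim v xs i), mk (Sum.elim w ys i)) ∈ G := by
      rintro (i | i)
      exacts [hv i, hx i]
    have key := hG.isPartialIso.fst_eq_fst_iff (mk_realize_mem hsum t₁) (mk_realize_mem hsum t₂)
    rw [mk_eq_mk, mk_eq_mk] at key
    have helim : ∀ {n : ℕ} (v : α → ℕ → ℚ_[p]) (xs : Fin n → ℕ → ℚ_[p]) (k : ℕ),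
        (fun i => Sum.elim v xs i k) = Sum.elim (fun i => v i k) fun j => xs j k := by
      intro n v xs k
      ext (i | i) <;> rfl
    simp only [helim] at key
    exact key
  | rel R => exact R.elim
  | imp φ ψ ihφ ihψ =>
    simp only [Language.BoundedFormula.realize_imp, Ultrafilter.eventually_imp]
    rw [ihφ hG hv hx, ihψ hG hv hx]
  | all φ ih =>
    have hsnoc : ∀ {n : ℕ} (xs : Fin n → ℕ → ℚ_[p]) (a : ℕ → ℚ_[p]) (k : ℕ),
        (fun j => (Fin.snoc xs a : Fin (n + 1) → ℕ → ℚ_[p]) j k) =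
          Fin.snoc (fun j => xs j k) (a k) := by
      intro n xs a k
      ext j
      refine Fin.lastCases ?_ (fun i => ?_) j <;> simp
    have hmem : ∀ {G' : Subring (PadicGerm p × PadicGerm p)}, G ≤ G' → ∀ {a b : ℕ → ℚ_[p]},
        (mk a, mk b) ∈ G' → ∀ j, (mk ((Fin.snoc xs a : Fin _ → ℕ → ℚ_[p]) j),
          mk ((Fin.snoc ys b : Fin _ → ℕ → ℚ_[p]) j)) ∈ G' := by
      intro G' hGG' a b hab j
      refine Fin.lastCases ?_ (fun i => ?_) j
      · simpa using hab
      · simpa using hGG' (hx i)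
    simp only [Language.BoundedFormula.realize_all]
    constructor
    · intro h
      by_contra hcon
      rw [← Ultrafilter.eventually_not] at hcon
      simp only [not_forall] at hcon
      obtain ⟨b, hb⟩ := hcon.choice
      obtain ⟨G', hG', hGG', ⟨a, c⟩, hac, rfl⟩ :=
        hG.exists_extend_snd isSaturatedHenselian (mk b)
      obtain ⟨a, rfl⟩ := exists_mk a
      have key := (ih hG' (fun i => hGG' (hv i)) (hmem hGG' hac)).1
        (by simpa only [hsnoc] using h.mono fun k hk => hk (a k))
      simp only [hsnoc] at key
      obtain ⟨k, hk, hk'⟩ := (key.and hb).exists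
      exact hk' hk
    · intro h
      by_contra hcon
      rw [← Ultrafilter.eventually_not] at hcon
      simp only [not_forall] at hcon
      obtain ⟨a, ha⟩ := hcon.choice
      obtain ⟨G', hG', hGG', ⟨c, b⟩, hac, rfl⟩ :=
        hG.exists_extend_fst isSaturatedHenselian (mk a)
      obtain ⟨b, rfl⟩ := exists_mk b
      have key := (ih hG' (fun i => hGG' (hv i)) (hmem hGG' hac)).2
        (by simpa only [hsnoc] using h.mono fun k hk => hk (b k))
      simp only [hsnoc] at key
      obtain ⟨k, hk, hk'⟩ := (key.and ha).exists
      exact hk' hk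

lemma isSystemInvariant_map {f : ℚ_[p] → ℚ_[p]}
    (hf : Set.Definable (Set.univ : Set ℚ_[p]) Language.ring {v : Fin 2 → ℚ_[p] | f (v 0) = v 1}) :
    IsSystemInvariant ℚ_[p] (val p) fun a b => Germ.map f a = b := by
  obtain ⟨φ, hφ⟩ := Set.definable_iff_exists_formula_sum.1 hf
  intro G hG ⟨a, a'⟩ ha ⟨b, b'⟩ hb
  obtain ⟨a, rfl⟩ := exists_mk a
  obtain ⟨a', rfl⟩ := exists_mk a'
  obtain ⟨b, rfl⟩ := exists_mk b
  obtain ⟨b', rfl⟩ := exists_mk b'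
  let V : ((Set.univ : Set ℚ_[p]) ⊕ Fin 2) → ℕ → ℚ_[p] := Sum.elim (fun s _ => s) ![a, b]
  let W : ((Set.univ : Set ℚ_[p]) ⊕ Fin 2) → ℕ → ℚ_[p] := Sum.elim (fun s _ => s) ![a', b']
  have hVW : ∀ i, (mk (V i), mk (W i)) ∈ G := by
    rintro (s | i)
    · exact hG.isPartialIso.const_mem s
    · fin_cases i
      exacts [ha, hb]
  have hmap : ∀ x y : ℕ → ℚ_[p], Germ.map f (mk x) = mk y ↔ ∀ᶠ k in hyperfilter ℕ,
      φ.Realize fun i => (Sum.elim (fun s _ => s) ![x, y] :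
        ((Set.univ : Set ℚ_[p]) ⊕ Fin 2) → ℕ → ℚ_[p]) i k := by
    intro x y
    change mk (f ∘ x) = mk y ↔ _
    rw [mk_eq_mk]
    refine eventually_congr (Eventually.of_forall fun k => ?_)
    have := Set.ext_iff.1 hφ ![x k, y k]
    refine this.trans ?_
    have he : (Sum.elim (↑) ![x k, y k] : ((Set.univ : Set ℚ_[p]) ⊕ Fin 2) → ℚ_[p]) =
        fun i => (Sum.elim (fun s _ => s) ![x, y] :
          ((Set.univ : Set ℚ_[p]) ⊕ Fin 2) → ℕ → ℚ_[p]) i k := by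
      ext (s | i)
      · rfl
      · fin_cases i <;> rfl
    rw [← he]
    rfl
  have key := eventually_realize_iff φ hG hVW (xs := Fin.elim0) (ys := Fin.elim0) (fun j => j.elim0)
  have h0 : ∀ k : ℕ, (fun j : Fin 0 => (Fin.elim0 j : ℕ → ℚ_[p]) k) =
      @default _ Unique.instInhabited :=
    fun k => Subsingleton.elim _ _
  simp only [h0] at key
  change Germ.map f (mk a) = mk b ↔ Germ.map f (mk a') = mk b'
  rw [hmap, hmap]
  exact key

end PadicGerm

end Transfer

section DefinableLimit

variable {p : ℕ} [Fact p.Prime]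

namespace PadicGerm

lemma val_mk_lt_one_of_tendsto {x : ℕ → ℚ_[p]} (hx : Tendsto x atTop (𝓝 0)) :
    val p (mk x) < 1 := by
  rw [val_mk_lt_one_iff]
  intro M
  have := hx.norm.const_mul M
  rw [norm_zero, mul_zero] at this
  exact Nat.hyperfilter_le_atTop (this.eventually (gt_mem_nhds one_pos))

lemma mk_mem_infDivisible_of_pow {n : ℕ} {u x : ℕ → ℚ_[p]}
    (h : ∀ k, u k ^ (n * k.factorial) = x k) : mk x ∈ infDivisible (PadicGerm p) := by
  rw [mk_mem_infDivisible]
  intro m hm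
  refine Nat.hyperfilter_le_atTop ?_
  filter_upwards [eventually_ge_atTop m] with k hk
  obtain ⟨r, hr⟩ := (Nat.dvd_factorial hm hk).mul_left n
  exact ⟨u k ^ r, by rw [← h k, hr, mul_comm m, pow_mul]⟩

end PadicGerm

lemma padic_tendsto_zero_of_le_valuation {x : ℕ → ℚ_[p]} (h0 : ∀ k, x k ≠ 0)
    (h : ∀ k : ℕ, (k : ℤ) ≤ (x k).valuation) : Tendsto x atTop (𝓝 0) := by
  have hp1 : (1 : ℝ) < p := by exact_mod_cast (Fact.out : p.Prime).one_lt
  rw [tendsto_zero_iff_norm_tendsto_zero]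
  refine squeeze_zero (fun k => norm_nonneg _) (fun k => ?_)
    (tendsto_pow_atTop_nhds_zero_of_lt_one (r := (p : ℝ)⁻¹) (by positivity)
      (inv_lt_one_of_one_lt₀ hp1))
  rw [Padic.norm_eq_zpow_neg_valuation (h0 k), inv_pow, ← zpow_natCast, ← zpow_neg]
  exact zpow_le_zpow_right₀ hp1.le (neg_le_neg (h k))

lemma self_le_mul_factorial {n : ℕ} (hn : 1 ≤ n) (k : ℕ) : k ≤ n * k.factorial :=
  (Nat.self_le_factorial k).trans (Nat.le_mul_of_pos_left _ hn)

open PadicGerm in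
/-- A definable function with unit values satisfies a Hölder bound at `0` along powers. -/
theorem exists_pow_norm_sub_le {n : ℕ} (hn : 1 ≤ n) {ε : ℤ} {f : ℚ_[p] → ℚ_[p]}
    (hf : Set.Definable (Set.univ : Set ℚ_[p]) Language.ring {v : Fin 2 → ℚ_[p] | f (v 0) = v 1})
    (hunit : ∀ x : ℚ_[p], x ≠ 0 → ε ≤ x.valuation → (∃ y, y ^ n = x) → ‖f x‖ = 1) :
    ∃ (L : ℚ_[p]) (N j : ℕ), ‖L‖ = 1 ∧ 0 < N ∧ ∀ x : ℚ_[p], x ≠ 0 → (j : ℤ) ≤ x.valuation →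
      (∃ y, y ^ (n * j.factorial) = x) → ‖f x - L‖ ^ N ≤ ‖x‖ := by
  have hp0 : (p : ℚ_[p]) ≠ 0 := by exact_mod_cast (Fact.out : p.Prime).ne_zero
  have hF := isSystemInvariant_map hf
  have huniq : ∀ x y y' : PadicGerm p, Germ.map f x = y → Germ.map f x = y' → y = y' :=
    fun _ _ _ h h' => h.symm.trans h'
  set x : ℕ → ℚ_[p] := fun k => (p : ℚ_[p]) ^ (n * k.factorial) with hx
  have hx0 : ∀ k, x k ≠ 0 := fun k => pow_ne_zero _ hp0
  have hxval : ∀ k : ℕ, (k : ℤ) ≤ (x k).valuation := fun k => by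
    rw [hx, Padic.valuation_pow, Padic.valuation_p, mul_one]
    exact_mod_cast self_le_mul_factorial hn k
  have hmk0 : ∀ {x : ℕ → ℚ_[p]}, (∀ k, x k ≠ 0) → mk x ≠ 0 :=
    fun h => mk_ne_zero.2 (Eventually.of_forall h)
  have hxlt := val_mk_lt_one_of_tendsto (padic_tendsto_zero_of_le_valuation hx0 hxval)
  have hfx : ∀ᶠ k in hyperfilter ℕ, ‖f (x k)‖ = 1 := by
    refine Nat.hyperfilter_le_atTop ?_
    filter_upwards [eventually_ge_atTop ε.toNat] with k hk
    refine hunit _ (hx0 k) ?_ ⟨(p : ℚ_[p]) ^ k.factorial, by rw [hx, ← pow_mul, mul_comm]⟩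
    have := hxval k
    omega
  obtain ⟨L, M, -, hL, hLM⟩ := hF.exists_pow_sub_le isSaturatedHenselian huniq
    (x := mk x) (y := mk fun k => f (x k)) rfl (hmk0 hx0) hxlt
    (val_mk_le_one_iff.2 ⟨1, hfx.mono fun k hk => hk.le⟩)
  have hL1 : ‖L‖ = 1 := by
    rw [algebraMap_eq, mk_sub, val_mk_lt_one_iff] at hL
    obtain ⟨k, hk, hk'⟩ := ((hL 1).and hfx).exists
    rw [one_mul] at hk
    rw [← hk'] at hk ⊢
    exact (Padic.norm_eq_of_norm_sub_lt_left hk).symm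
  suffices h : ∃ j : ℕ, ∀ x : ℚ_[p], x ≠ 0 → (j : ℤ) ≤ x.valuation →
      (∃ y, y ^ (n * j.factorial) = x) → ‖f x - L‖ ^ (M + 1) ≤ ‖x‖ from
    h.elim fun j hj => ⟨L, M + 1, j, hL1, M.succ_pos, hj⟩
  by_contra! hcon
  choose z hz0 hzval hu hz using hcon
  choose u hu using hu
  have hzlt := val_mk_lt_one_of_tendsto (padic_tendsto_zero_of_le_valuation hz0 hzval)
  have hdiv : mk x / mk z ∈ infDivisible (PadicGerm p) := by
    rw [mk_div]
    refine mk_mem_infDivisible_of_pow (n := n) (u := fun k => (p : ℚ_[p]) / u k) fun k => ?_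
    rw [div_pow, hu, hx]
  have hle := hF.pow_sub_le isSaturatedHenselian huniq (x' := mk z) (y' := mk fun k => f (z k))
    rfl rfl (hmk0 hx0) hxlt (hmk0 hz0) hzlt hdiv hLM
  have hlt : val p (mk (fun k => f (z k)) - algebraMap ℚ_[p] (PadicGerm p) L) < 1 :=
    lt_of_not_ge fun h => (hle.trans_lt hzlt).not_ge (one_le_pow_of_one_le' h M)
  rw [algebraMap_eq, mk_sub, val_mk_lt_one_iff] at hlt
  rw [algebraMap_eq, mk_sub, ← map_pow, mk_pow, val_mk_le_iff] at hle
  obtain ⟨C, hC⟩ := hle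
  obtain ⟨k, hk, hk'⟩ := (hC.and (hlt C)).exists
  refine (hz k).not_ge ?_
  rw [norm_pow] at hk
  calc ‖f (z k) - L‖ ^ (M + 1) ≤ C * ‖z k‖ * ‖f (z k) - L‖ := by
        rw [pow_succ]
        gcongr
    _ = C * ‖f (z k) - L‖ * ‖z k‖ := by ring
    _ ≤ ‖z k‖ := mul_le_of_le_one_left (norm_nonneg _) hk'.le

end DefinableLimit

/-- **Unit-valued definable functions have a limit at `0` along powers.**
Let `f : ℚ_p → ℚ_p` be definable with `‖f x‖ = 1` on `D = {x ≠ 0 : v(x) ≥ ε, x ∈ P_n}`.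
Then there are `δ ≥ ε`, a positive multiple `m` of `n`, and `L` with `‖L‖ = 1` such that
`f x → L` as `x → 0` within `{x ≠ 0 : v(x) ≥ δ, x ∈ P_m}`. -/
theorem stmt17 (p : ℕ) [Fact p.Prime] (n : ℕ) (hn : 1 ≤ n) (ε : ℤ)
    (f : ℚ_[p] → ℚ_[p])
    (hfdef : Set.Definable (Set.univ : Set ℚ_[p]) FirstOrder.Language.ring
      {v : Fin 2 → ℚ_[p] | f (v 0) = v 1})
    (hunit : ∀ x : ℚ_[p], x ≠ 0 → ε ≤ x.valuation → (∃ y : ℚ_[p], y ^ n = x) →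
      ‖f x‖ = 1) :
    ∃ δ : ℤ, ε ≤ δ ∧ ∃ m : ℕ, 0 < m ∧ n ∣ m ∧ ∃ L : ℚ_[p], ‖L‖ = 1 ∧
      Filter.Tendsto f
        (𝓝[{x : ℚ_[p] | x ≠ 0 ∧ δ ≤ x.valuation ∧ ∃ y : ℚ_[p], y ^ m = x}] 0)
        (𝓝 L) := by
  obtain ⟨L, N, j, hL, hN, h⟩ := exists_pow_norm_sub_le hn hfdef hunit
  refine ⟨max ε j, le_max_left _ _, n * j.factorial, Nat.mul_pos hn j.factorial_pos,
    dvd_mul_right _ _, L, hL, ?_⟩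
  rw [Metric.tendsto_nhdsWithin_nhds]
  refine fun r hr => ⟨r ^ N, pow_pos hr N, fun x ⟨hx0, hxval, hxpow⟩ hx => ?_⟩
  rw [dist_zero_right] at hx
  rw [dist_eq_norm]
  exact lt_of_pow_lt_pow_left₀ N hr.le
    ((h x hx0 ((le_max_right _ _).trans hxval) hxpow).trans_lt hx)
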